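/- Fix ζ ∈ (0,1] and c > 0 with 2ζc² < 1, and let λ : ℕ → (0,∞) be any sequence with √n·λ(n) → c. Then each of the following events holds with probability at least 1 − n^{-K}, for every fixed K > 0 and all n sufficiently large, where G ~ μ_{λ(n),ζ}: (1) Δ(G) − δ(G) ≤ 4·√(n·λ(n))·log n, where Δ and δ are the maximum and minimum degree; (2) | |G| − E|G| | ≤ n·√(λ(n))·log n; (3) | X(G) − E X(G) | ≤ n²·λ(n)^{3/2}·(log n)³. -/

import Mathlib

open Filter
open scoped BigOperators symmDiff Classical

noncomputable section

/-- Number of edges of a labeled simple graph on `Fin n`. -/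
def edgeCount {n : ℕ} (G : SimpleGraph (Fin n)) : ℕ := Nat.card G.edgeSet

/-- Number of triangles of a labeled simple graph on `Fin n`. -/
def triCount {n : ℕ} (G : SimpleGraph (Fin n)) : ℕ :=
  Nat.card {s : Finset (Fin n) // G.IsNClique 3 s}

/-- Probability of the event `A` under the Erdős–Rényi random graph `G(n,p)`. -/
def erProb (n : ℕ) (p : ℝ) (A : Set (SimpleGraph (Fin n))) : ℝ :=
  ∑ G : SimpleGraph (Fin n),
    if G ∈ A then p ^ edgeCount G * (1 - p) ^ (n.choose 2 - edgeCount G) else 0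

/-- Conditional probability `P_p(A | B)` for `G(n,p)`. -/
def erCondProb (n : ℕ) (p : ℝ) (A B : Set (SimpleGraph (Fin n))) : ℝ :=
  erProb n p (A ∩ B) / erProb n p B

/-- Probability of the event `A` under the uniform random graph `G(n,m)`. -/
def gnmProb (n m : ℕ) (A : Set (SimpleGraph (Fin n))) : ℝ :=
  (Nat.card {G : SimpleGraph (Fin n) // edgeCount G = m ∧ G ∈ A} : ℝ) /
    ((n.choose 2).choose m : ℝ)

/-- Expected number of triangles of `G(n,m)`. -/
def gnmExpTri (n m : ℕ) : ℝ :=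
  (∑ G : SimpleGraph (Fin n), if edgeCount G = m then (triCount G : ℝ) else 0) /
    ((n.choose 2).choose m : ℝ)

/-- Gibbs weight `λ^{|G|} (1-ζ)^{X(G)}`. -/
def gibbsWeight {n : ℕ} (lam zeta : ℝ) (G : SimpleGraph (Fin n)) : ℝ :=
  lam ^ edgeCount G * (1 - zeta) ^ triCount G

/-- The partition function `Z(λ,ζ)`. -/
def Zfun (n : ℕ) (lam zeta : ℝ) : ℝ := ∑ G : SimpleGraph (Fin n), gibbsWeight lam zeta G

/-- Probability of the event `A` under the Gibbs measure `μ_{λ,ζ}`. -/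
def gibbsProb (n : ℕ) (lam zeta : ℝ) (A : Set (SimpleGraph (Fin n))) : ℝ :=
  (∑ G : SimpleGraph (Fin n), if G ∈ A then gibbsWeight lam zeta G else 0) / Zfun n lam zeta

/-- Expectation of `f` under the Gibbs measure `μ_{λ,ζ}`. -/
def gibbsExp (n : ℕ) (lam zeta : ℝ) (f : SimpleGraph (Fin n) → ℝ) : ℝ :=
  (∑ G : SimpleGraph (Fin n), f G * gibbsWeight lam zeta G) / Zfun n lam zeta

/-- Number of edges of `H` with both endpoints in `S`. -/
def edgesIn {V : Type*} (H : SimpleGraph V) (S : Finset V) : ℕ :=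
  Nat.card {e : Sym2 V // e ∈ H.edgeSet ∧ ∀ v ∈ e, v ∈ S}

/-- Weight `λ^{|S|} (1-ζ)^{|E(S)|}` of the measure `ν_{H,λ,ζ}`. -/
def nuWeight {V : Type*} (H : SimpleGraph V) (lam zeta : ℝ) (S : Finset V) : ℝ :=
  lam ^ S.card * (1 - zeta) ^ edgesIn H S

/-- The partition function `Ξ_H(λ,ζ)`. -/
def XiFun {V : Type*} [Fintype V] (H : SimpleGraph V) (lam zeta : ℝ) : ℝ :=
  ∑ S : Finset V, nuWeight H lam zeta S

/-- The probability of `S` under `ν_{H,λ,ζ}`. -/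
def nuProb {V : Type*} [Fintype V] (H : SimpleGraph V) (lam zeta : ℝ) (S : Finset V) : ℝ :=
  nuWeight H lam zeta S / XiFun H lam zeta

/-- `W` is the Lambert-W function on `[0,∞)`: for `x ≥ 0`, `W x` is the unique `w ≥ 0`
with `w·e^w = x`. -/
def IsLambertW (W : ℝ → ℝ) : Prop :=
  ∀ x : ℝ, 0 ≤ x → (0 ≤ W x ∧ W x * Real.exp (W x) = x ∧
    ∀ w : ℝ, 0 ≤ w → w * Real.exp w = x → w = W x)

/-- `η* = (W(2/e)/(2/e))^{3/2}`. -/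
def etaStar (W : ℝ → ℝ) : ℝ := (W (2 / Real.exp 1) / (2 / Real.exp 1)) ^ ((3 : ℝ) / 2)

/-- The condition `c < c̄(η)` where `c̄(η) = 1/√(e(1−η/η*))` for `η < η*` and `+∞` otherwise. -/
def LtCbar (W : ℝ → ℝ) (c η : ℝ) : Prop :=
  η < etaStar W → c < 1 / Real.sqrt (Real.exp 1 * (1 - η / etaStar W))

/-- The left-hand side of the equation defining `ζ(c,η)`, interpreted as `1` at `ζ = 0`. -/
def zetaLHS (W : ℝ → ℝ) (c zeta : ℝ) : ℝ :=
  (1 - zeta) * (if zeta = 0 then 1 else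
    (W (2 * zeta * c ^ 2) / (2 * zeta * c ^ 2)) ^ ((3 : ℝ) / 2))



/-- Degree of a vertex. -/
def degN {n : ℕ} (G : SimpleGraph (Fin n)) (v : Fin n) : ℕ := Nat.card (G.neighborSet v)

/-- Maximum degree. -/
def maxDegN {n : ℕ} (G : SimpleGraph (Fin n)) : ℕ := Finset.univ.sup (degN G)

/-- Minimum degree. -/
def minDegN {n : ℕ} (G : SimpleGraph (Fin n)) : ℕ := sInf (Set.range (degN G))

/-! ### Weighted spin systems on the subsets of a finite set -/

section SpinSystem

set_option linter.unusedSectionVars false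

variable {E : Type*} [Fintype E] [DecidableEq E]

/-- Expectation of `f` under the probability measure proportional to `w`. -/
def wExp (w f : Finset E → ℝ) : ℝ := (∑ σ, f σ * w σ) / ∑ σ, w σ

/-- `r e σ` is the conditional odds of `e` being present, given the rest of `σ`,
under the measure proportional to `w`. -/
structure HasOdds (w : Finset E → ℝ) (r : E → Finset E → ℝ) : Prop where
  nonneg : ∀ σ, 0 ≤ w σ
  pos : 0 < w ∅
  odds_nonneg : ∀ e σ, 0 ≤ r e σ
  weight_insert : ∀ e σ, e ∉ σ → w (insert e σ) = r e σ * w σ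
  odds_insert : ∀ e σ, r e (insert e σ) = r e σ

/-- Conditional probability of `e` being present when its odds are `r e σ`. -/
def upProb (r : E → Finset E → ℝ) (e : E) (σ : Finset E) : ℝ := r e σ / (1 + r e σ)

/-- Sum over `e` of the conditional expectations of `f` after resampling `e`. -/
def glauber (r : E → Finset E → ℝ) (f : Finset E → ℝ) (σ : Finset E) : ℝ :=
  ∑ e, (f (σ.erase e) + upProb r e σ * (f (insert e σ) - f (σ.erase e)))

/-- Adding an element changes `f` by at most `K`, as long as the outcome lies in `𝒢`. -/
def FlipLipOn (𝒢 : Set (Finset E)) (K : ℝ) (f : Finset E → ℝ) : Prop :=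
  ∀ e σ, insert e σ ∈ 𝒢 → |f (insert e σ) - f σ| ≤ K

lemma sum_eq_sum_pairs (e : E) (h : Finset E → ℝ) :
    ∑ σ, h σ = ∑ σ ∈ (Finset.univ.erase e).powerset, (h σ + h (insert e σ)) := by
  have key := Finset.sum_powerset_insert (Finset.notMem_erase e (Finset.univ : Finset E)) h
  rw [Finset.insert_erase (Finset.mem_univ e), Finset.powerset_univ] at key
  rw [key, Finset.sum_add_distrib]

lemma sum_le_sum_of_pairs (e : E) {h h' : Finset E → ℝ}
    (H : ∀ σ, e ∉ σ → h σ + h (insert e σ) ≤ h' σ + h' (insert e σ)) :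
    ∑ σ, h σ ≤ ∑ σ, h' σ := by
  rw [sum_eq_sum_pairs e h, sum_eq_sum_pairs e h']
  refine Finset.sum_le_sum fun σ hσ => H σ fun he => ?_
  simpa using Finset.mem_powerset.1 hσ he

section wExp

variable {w : Finset E → ℝ}

lemma wExp_mono (hw : ∀ σ, 0 ≤ w σ) {f g : Finset E → ℝ} (h : ∀ σ, f σ ≤ g σ) :
    wExp w f ≤ wExp w g :=
  div_le_div_of_nonneg_right
    (Finset.sum_le_sum fun σ _ => mul_le_mul_of_nonneg_right (h σ) (hw σ))
    (Finset.sum_nonneg fun σ _ => hw σ)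

lemma wExp_add (f g : Finset E → ℝ) :
    wExp w (fun σ => f σ + g σ) = wExp w f + wExp w g := by
  simp only [wExp, add_mul, Finset.sum_add_distrib, add_div]

lemma wExp_sub (f g : Finset E → ℝ) :
    wExp w (fun σ => f σ - g σ) = wExp w f - wExp w g := by
  simp only [wExp, sub_mul, Finset.sum_sub_distrib, sub_div]

lemma wExp_const_mul (a : ℝ) (f : Finset E → ℝ) :
    wExp w (fun σ => a * f σ) = a * wExp w f := by
  simp only [wExp, mul_assoc, ← Finset.mul_sum, mul_div_assoc]

lemma wExp_neg (f : Finset E → ℝ) : wExp w (fun σ => -f σ) = -wExp w f := by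
  simp only [wExp, neg_mul, Finset.sum_neg_distrib, neg_div]

lemma wExp_sum {ι : Type*} (s : Finset ι) (f : ι → Finset E → ℝ) :
    wExp w (fun σ => ∑ i ∈ s, f i σ) = ∑ i ∈ s, wExp w (f i) := by
  simp only [wExp, Finset.sum_mul]
  rw [Finset.sum_comm, Finset.sum_div]

lemma wExp_const (hZ : 0 < ∑ σ, w σ) (a : ℝ) : wExp w (fun _ => a) = a := by
  simp only [wExp, ← Finset.mul_sum]
  field_simp

end wExp

namespace HasOdds

variable {w w' : Finset E → ℝ} {r r' : E → Finset E → ℝ}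

lemma sum_pos (h : HasOdds w r) : 0 < ∑ σ, w σ :=
  Finset.sum_pos' (fun σ _ => h.nonneg σ) ⟨∅, Finset.mem_univ _, h.pos⟩

lemma upProb_nonneg (h : HasOdds w r) (e : E) (σ : Finset E) : 0 ≤ upProb r e σ := by
  have := h.odds_nonneg e σ
  unfold upProb; positivity

lemma upProb_le_one (h : HasOdds w r) (e : E) (σ : Finset E) : upProb r e σ ≤ 1 := by
  have := h.odds_nonneg e σ
  unfold upProb
  rw [div_le_one (by positivity)]; linarith

lemma upProb_insert (h : HasOdds w r) (e : E) (σ : Finset E) :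
    upProb r e (insert e σ) = upProb r e σ := by
  simp only [upProb, h.odds_insert]

/-- The heat-bath update of a single element preserves expectations. -/
lemma wExp_update (h : HasOdds w r) (f : Finset E → ℝ) (e : E) :
    wExp w (fun σ => f (σ.erase e) + upProb r e σ * (f (insert e σ) - f (σ.erase e)))
      = wExp w f := by
  unfold wExp
  congr 1
  rw [sum_eq_sum_pairs e, sum_eq_sum_pairs e (fun σ => f σ * w σ)]
  refine Finset.sum_congr rfl fun σ hσ => ?_
  have he : e ∉ σ := fun he => by simpa using Finset.mem_powerset.1 hσ he
  have h0 : 0 < 1 + r e σ := by linarith [h.odds_nonneg e σ]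
  simp only [h.odds_insert, Finset.insert_idem, Finset.erase_insert he,
    Finset.erase_eq_of_notMem he, h.weight_insert e σ he, upProb]
  field_simp
  ring

lemma wExp_glauber (h : HasOdds w r) (f : Finset E → ℝ) :
    wExp w (glauber r f) = Fintype.card E * wExp w f := by
  unfold glauber
  rw [wExp_sum]
  simp [h.wExp_update f]

/-- Domination by independent elements, in terms of exponential moments. -/
lemma wExp_prod_le (h : HasOdds w r) {l a : ℝ} (ha : 0 ≤ a) (hr : ∀ e σ, r e σ ≤ l)
    (S : Finset E) :
    wExp w (fun σ => ∏ e ∈ S, (1 + if e ∈ σ then a else 0)) ≤ (1 + a * l) ^ S.card := by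
  unfold wExp
  rw [div_le_iff₀ h.sum_pos]
  induction S using Finset.induction_on with
  | empty => simp
  | insert e S he ih =>
    rw [Finset.card_insert_of_notMem he, pow_succ', mul_assoc]
    have hl : 0 ≤ l := (h.odds_nonneg e ∅).trans (hr e ∅)
    refine le_trans ?_ (mul_le_mul_of_nonneg_left ih (by positivity))
    rw [Finset.mul_sum]
    refine sum_le_sum_of_pairs e fun σ hσ => ?_
    have hprod : ∏ x ∈ S, (1 + if x ∈ insert e σ then a else 0)
        = ∏ x ∈ S, (1 + if x ∈ σ then a else 0) := by
      refine Finset.prod_congr rfl fun x hx => ?_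
      have : x ≠ e := fun hxe => he (hxe ▸ hx)
      simp [Finset.mem_insert, this]
    have hP : 0 ≤ ∏ x ∈ S, (1 + if x ∈ σ then a else 0) :=
      Finset.prod_nonneg fun x _ => by split_ifs <;> linarith
    beta_reduce
    rw [Finset.prod_insert he, Finset.prod_insert he, hprod, h.weight_insert e σ hσ]
    simp only [hσ, if_false, Finset.mem_insert_self, if_true]
    set Q := ∏ x ∈ S, (1 + if x ∈ σ then a else 0)
    have h1 := h.nonneg σ
    have h2 := h.odds_nonneg e σ
    have h3 := hr e σ
    have h4 : 0 ≤ a * (l - r e σ) * (Q * w σ) :=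
      mul_nonneg (mul_nonneg ha (by linarith)) (mul_nonneg hP h1)
    have h5 : 0 ≤ a * l * r e σ * (Q * w σ) := by positivity
    nlinarith

lemma tail_card_inter (h : HasOdds w r) {l : ℝ} (hr : ∀ e σ, r e σ ≤ l) (hl : 0 ≤ l)
    {s : ℝ} (hs : 0 ≤ s) (S : Finset E) {M T : ℝ} (hM : (S.card : ℝ) ≤ M) :
    wExp w (fun σ => if T < ((σ ∩ S).card : ℝ) then 1 else 0)
      ≤ Real.exp (-(s * T) + M * ((Real.exp s - 1) * l)) := by
  have ha : 0 ≤ Real.exp s - 1 := by linarith [Real.add_one_le_exp s]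
  have hprod : ∀ σ : Finset E, ∏ e ∈ S, (1 + if e ∈ σ then Real.exp s - 1 else 0)
      = Real.exp (s * (σ ∩ S).card) := by
    intro σ
    have : ∀ e ∈ S, (1 + if e ∈ σ then Real.exp s - 1 else 0)
        = if e ∈ σ then Real.exp s else 1 := by
      intro e _; split_ifs <;> ring
    rw [Finset.prod_congr rfl this, Finset.prod_ite, Finset.prod_const, Finset.prod_const_one,
      mul_one, Finset.filter_mem_eq_inter, Finset.inter_comm, ← Real.exp_nat_mul, mul_comm]
  calc wExp w (fun σ => if T < ((σ ∩ S).card : ℝ) then 1 else 0)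
      ≤ wExp w (fun σ => Real.exp (-(s * T)) *
          ∏ e ∈ S, (1 + if e ∈ σ then Real.exp s - 1 else 0)) := by
        refine wExp_mono h.nonneg fun σ => ?_
        rw [hprod, ← Real.exp_add]
        split_ifs with hT
        · exact Real.one_le_exp (by nlinarith)
        · positivity
    _ ≤ Real.exp (-(s * T)) * (1 + (Real.exp s - 1) * l) ^ S.card := by
        rw [wExp_const_mul]
        exact mul_le_mul_of_nonneg_left (h.wExp_prod_le ha hr S) (Real.exp_pos _).le
    _ ≤ Real.exp (-(s * T)) * Real.exp (S.card * ((Real.exp s - 1) * l)) := by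
        rw [Real.exp_nat_mul]
        gcongr
        linarith [Real.add_one_le_exp ((Real.exp s - 1) * l)]
    _ ≤ _ := by
        rw [← Real.exp_add]
        gcongr

/-- One-step contraction of the heat-bath dynamics. -/
lemma flipLipOn_glauber (h : HasOdds w r) {𝒢 : Set (Finset E)} {θ : ℝ} (hθ0 : 0 ≤ θ)
    (hθ : ∀ g σ, g ∉ σ → insert g σ ∈ 𝒢 →
      ∑ e ∈ Finset.univ.erase g, |upProb r e (insert g σ) - upProb r e σ| ≤ θ)
    {f : Finset E → ℝ} (hf : FlipLipOn Set.univ 1 f) :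
    FlipLipOn 𝒢 (Fintype.card E - 1 + θ) (glauber r f) := by
  intro g σ hG
  have hN : (1 : ℝ) ≤ Fintype.card E := by
    exact_mod_cast Fintype.card_pos_iff.2 ⟨g⟩
  by_cases hg : g ∈ σ
  · rw [Finset.insert_eq_of_mem hg, sub_self, abs_zero]; linarith
  have hf' : ∀ e σ, |f (insert e σ) - f σ| ≤ 1 := fun e σ => hf e σ trivial
  unfold glauber
  rw [← Finset.sum_sub_distrib, ← Finset.add_sum_erase _ _ (Finset.mem_univ g)]
  rw [h.upProb_insert, Finset.insert_idem, Finset.erase_insert hg, Finset.erase_eq_of_notMem hg,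
    sub_self, zero_add]
  refine (Finset.abs_sum_le_sum_abs _ _).trans ?_
  calc _ ≤ ∑ e ∈ Finset.univ.erase g, (1 + |upProb r e (insert g σ) - upProb r e σ|) := by
        refine Finset.sum_le_sum fun e he => ?_
        have hne : e ≠ g := Finset.ne_of_mem_erase he
        rw [Finset.erase_insert_of_ne hne.symm, Finset.insert_comm e g σ]
        have h1 := hf' g (σ.erase e)
        have h2 := hf' g (insert e σ)
        have h3 := hf' e (insert g (σ.erase e))
        have h4 : insert e (insert g (σ.erase e)) = insert g (insert e σ) := by
          rw [Finset.insert_comm]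
          congr 1
          ext x; simp only [Finset.mem_insert, Finset.mem_erase]; tauto
        rw [h4] at h3
        have p0 := h.upProb_nonneg e σ
        have p1 := h.upProb_le_one e σ
        generalize upProb r e σ = p at *
        generalize upProb r e (insert g σ) = p' at *
        generalize f (σ.erase e) = a at *
        generalize f (insert e σ) = b at *
        generalize f (insert g (σ.erase e)) = a' at *
        generalize f (insert g (insert e σ)) = b' at *
        have : a' + p' * (b' - a') - (a + p * (b - a))
            = (1 - p) * (a' - a) + p * (b' - b) + (p' - p) * (b' - a') := by ring
        rw [this]
        refine (abs_add_le _ _).trans (add_le_add ((abs_add_le _ _).trans ?_) ?_)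
        · rw [abs_mul, abs_mul, abs_of_nonneg p0, abs_of_nonneg (by linarith : 0 ≤ 1 - p)]
          nlinarith
        · rw [abs_mul]
          exact mul_le_of_le_one_right (abs_nonneg _) h3
    _ ≤ _ := by
        rw [Finset.sum_add_distrib, Finset.sum_const, Finset.card_erase_of_mem (Finset.mem_univ g),
          Finset.card_univ, nsmul_eq_mul, mul_one, Nat.cast_sub (by exact_mod_cast hN)]
        simpa using hθ g σ hg hG

end HasOdds

namespace FlipLipOn

variable {𝒢 : Set (Finset E)} {K : ℝ} {f : Finset E → ℝ}

lemma abs_union_sub_le (hG : IsLowerSet 𝒢) (hf : FlipLipOn 𝒢 K f) (σ s : Finset E)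
    (hdisj : Disjoint σ s) (h : σ ∪ s ∈ 𝒢) : |f (σ ∪ s) - f σ| ≤ K * s.card := by
  induction s using Finset.induction_on with
  | empty => simp
  | insert e s he ih =>
    rw [Finset.union_insert] at h ⊢
    have h1 := ih (hdisj.mono_right (Finset.subset_insert e s)) (hG (Finset.subset_insert _ _) h)
    have h2 := hf e _ h
    rw [Finset.card_insert_of_notMem he]
    push_cast
    calc |f (insert e (σ ∪ s)) - f σ|
        ≤ |f (insert e (σ ∪ s)) - f (σ ∪ s)| + |f (σ ∪ s) - f σ| := abs_sub_le _ _ _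
      _ ≤ _ := by linarith

lemma abs_sub_le (hG : IsLowerSet 𝒢) (hf : FlipLipOn 𝒢 K f) {σ τ : Finset E}
    (hσ : σ ∈ 𝒢) (hτ : τ ∈ 𝒢) : |f σ - f τ| ≤ K * (σ ∆ τ).card := by
  have key : ∀ σ τ : Finset E, σ ∈ 𝒢 → |f σ - f (σ ∩ τ)| ≤ K * (σ \ τ).card := by
    intro σ τ hσ
    have h := hf.abs_union_sub_le hG (σ ∩ τ) (σ \ τ)
      (Finset.disjoint_sdiff_inter σ τ).symm
    rw [Finset.union_comm, Finset.sdiff_union_inter] at h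
    exact h hσ
  have h1 := key σ τ hσ
  have h2 := key τ σ hτ
  rw [Finset.inter_comm τ σ] at h2
  have hc : (σ ∆ τ).card = (σ \ τ).card + (τ \ σ).card :=
    Finset.card_union_of_disjoint disjoint_sdiff_sdiff
  rw [hc]
  push_cast
  have := _root_.abs_sub_le (f σ) (f (σ ∩ τ)) (f τ)
  rw [abs_sub_comm (f (σ ∩ τ))] at this
  linarith

/-- A function that is Lipschitz on a lower set agrees there with a function that is Lipschitz
everywhere. -/
lemma exists_extension (hG : IsLowerSet 𝒢) (h0 : ∅ ∈ 𝒢) (hK : 0 ≤ K) (hf : FlipLipOn 𝒢 K f)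
    {M : ℝ} (hM : ∀ σ, |f σ| ≤ M) :
    ∃ g : Finset E → ℝ, FlipLipOn Set.univ K g ∧ (∀ σ ∈ 𝒢, g σ = f σ) ∧
      ∀ σ, |f σ - g σ| ≤ 2 * M + K * Fintype.card E := by
  set s : Finset (Finset E) := Finset.univ.filter (· ∈ 𝒢) with hs
  have hne : s.Nonempty := ⟨∅, by simp [hs, h0]⟩
  let F : Finset E → Finset E → ℝ := fun σ τ => f τ + K * (σ ∆ τ).card
  have hdist : ∀ (e : E) (σ τ : Finset E), |((insert e σ ∆ τ).card : ℝ) - (σ ∆ τ).card| ≤ 1 := by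
    intro e σ τ
    have h1 : insert e σ ∆ τ ⊆ insert e (σ ∆ τ) := by
      intro x; simp only [Finset.mem_symmDiff, Finset.mem_insert]; tauto
    have h2 : σ ∆ τ ⊆ insert e (insert e σ ∆ τ) := by
      intro x; simp only [Finset.mem_symmDiff, Finset.mem_insert]; tauto
    have h3 := (Finset.card_le_card h1).trans (Finset.card_insert_le _ _)
    have h4 := (Finset.card_le_card h2).trans (Finset.card_insert_le _ _)
    have h3' : ((insert e σ ∆ τ).card : ℝ) ≤ (σ ∆ τ).card + 1 := by exact_mod_cast h3
    have h4' : ((σ ∆ τ).card : ℝ) ≤ (insert e σ ∆ τ).card + 1 := by exact_mod_cast h4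
    rw [abs_le]; constructor <;> linarith
  refine ⟨fun σ => s.inf' hne (F σ), ?_, ?_, ?_⟩
  · intro e σ _
    have key : ∀ σ σ' : Finset E, (∀ τ, |((σ ∆ τ).card : ℝ) - (σ' ∆ τ).card| ≤ 1) →
        s.inf' hne (F σ) - K ≤ s.inf' hne (F σ') := by
      intro σ σ' h
      refine Finset.le_inf' hne _ fun τ hτ => ?_
      have h1 := Finset.inf'_le (F σ) hτ
      have h2 := mul_le_mul_of_nonneg_left (abs_le.1 (h τ)).2 hK
      simp only [F] at h1 ⊢
      linarith
    have h1 := key _ _ (hdist e σ)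
    have h2 := key σ (insert e σ) fun τ => by rw [abs_sub_comm]; exact hdist e σ τ
    rw [abs_le]; constructor <;> linarith
  · intro σ hσ
    have hσ' : σ ∈ s := by simp [hs, hσ]
    refine le_antisymm ?_ (Finset.le_inf' hne _ fun τ hτ => ?_)
    · refine (Finset.inf'_le (F σ) hσ').trans ?_
      simp [F]
    · have hτ' : τ ∈ 𝒢 := by simpa [hs] using hτ
      have := (abs_le.1 (hf.abs_sub_le hG hσ hτ')).2
      simp only [F]; linarith
  · intro σ
    have hub : s.inf' hne (F σ) ≤ M + K * Fintype.card E := by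
      refine (Finset.inf'_le (F σ) (b := ∅) (by simp [hs, h0])).trans ?_
      have h1 := (abs_le.1 (hM ∅)).2
      have h2 : ((σ ∆ ∅).card : ℝ) ≤ Fintype.card E := by exact_mod_cast Finset.card_le_univ _
      have h3 := mul_le_mul_of_nonneg_left h2 hK
      simp only [F]; linarith
    have hlb : -M ≤ s.inf' hne (F σ) := by
      refine Finset.le_inf' hne _ fun τ _ => ?_
      have h1 := (abs_le.1 (hM τ)).1
      have h2 : 0 ≤ K * ((σ ∆ τ).card : ℝ) := by positivity
      simp only [F]; linarith
    have h1 := abs_le.1 (hM σ)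
    have h2 : 0 ≤ K * (Fintype.card E : ℝ) := by positivity
    have h3 := h1.1
    have h4 := h1.2
    rw [abs_le]; constructor <;> linarith

lemma abs_sub_empty_le (hf : FlipLipOn Set.univ 1 f) (σ : Finset E) :
    |f σ - f ∅| ≤ Fintype.card E := by
  have h := hf.abs_sub_le (fun _ _ _ _ => trivial) (σ := σ) (τ := ∅) trivial trivial
  refine h.trans ?_
  rw [one_mul]
  exact_mod_cast Finset.card_le_univ _

end FlipLipOn

/-- The probability that `𝒢` fails, under the measure proportional to `w`. -/
def badProb (w : Finset E → ℝ) (𝒢 : Set (Finset E)) : ℝ :=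
  wExp w fun σ => if σ ∈ 𝒢 then 0 else 1

section Transport

variable {w w' : Finset E → ℝ} {r r' : E → Finset E → ℝ} {𝒢 : Set (Finset E)}

lemma HasOdds.badProb_nonneg (h : HasOdds w r) : 0 ≤ badProb w 𝒢 := by
  rw [← wExp_const h.sum_pos 0]
  exact wExp_mono h.nonneg fun σ => by split_ifs <;> norm_num

/-- An expectation is bounded by a bound valid on `𝒢` and a correction from its complement. -/
lemma HasOdds.wExp_le_of_good (h : HasOdds w r) {f : Finset E → ℝ} {A B : ℝ} (hA0 : 0 ≤ A)
    (hA : ∀ σ ∈ 𝒢, f σ ≤ A) (hB : ∀ σ, f σ ≤ B) : wExp w f ≤ A + B * badProb w 𝒢 := by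
  have : A + B * badProb w 𝒢 = wExp w (fun σ => A + B * if σ ∈ 𝒢 then 0 else 1) := by
    rw [wExp_add (fun _ => A), wExp_const h.sum_pos, wExp_const_mul, badProb]
  rw [this]
  refine wExp_mono h.nonneg fun σ => ?_
  by_cases hσ : σ ∈ 𝒢
  · simpa [hσ] using hA σ hσ
  · simp only [hσ, if_false]; linarith [hB σ]

lemma wExp_sub_le_of_flipLipOn (h : HasOdds w r) (h' : HasOdds w' r')
    (hG : IsLowerSet 𝒢) (h0 : ∅ ∈ 𝒢) {β W : ℝ}
    (hβ : badProb w 𝒢 ≤ β) (hβ' : badProb w' 𝒢 ≤ β)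
    (hW : ∀ f, FlipLipOn Set.univ 1 f → wExp w f - wExp w' f ≤ W)
    {K M : ℝ} (hK : 0 < K) {f : Finset E → ℝ} (hf : FlipLipOn 𝒢 K f) (hM : ∀ σ, |f σ| ≤ M) :
    wExp w f - wExp w' f ≤ K * W + 2 * (2 * M + K * Fintype.card E) * β := by
  obtain ⟨g, hg, hgf, hgM⟩ := hf.exists_extension hG h0 hK.le hM
  set B := 2 * M + K * Fintype.card E with hB
  have hB0 : 0 ≤ B := (abs_nonneg _).trans (hgM ∅)
  have hg1 : wExp w g - wExp w' g ≤ K * W := by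
    have := hW (fun σ => K⁻¹ * g σ) fun e σ hs => by
      rw [← mul_sub, abs_mul, abs_of_pos (inv_pos.2 hK), inv_mul_le_iff₀ hK, mul_one]
      exact hg e σ hs
    rw [wExp_const_mul, wExp_const_mul, ← mul_sub, inv_mul_le_iff₀ hK] at this
    exact this
  have h1 : wExp w (fun σ => f σ - g σ) ≤ 0 + B * badProb w 𝒢 :=
    h.wExp_le_of_good le_rfl (fun σ hσ => by rw [hgf σ hσ, sub_self])
      fun σ => (abs_le.1 (hgM σ)).2
  have h2 : wExp w' (fun σ => g σ - f σ) ≤ 0 + B * badProb w' 𝒢 :=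
    h'.wExp_le_of_good le_rfl (fun σ hσ => by rw [hgf σ hσ, sub_self])
      fun σ => by linarith [(abs_le.1 (hgM σ)).1]
  rw [wExp_sub] at h1 h2
  have h3 := mul_le_mul_of_nonneg_left hβ hB0
  have h4 := mul_le_mul_of_nonneg_left hβ' hB0
  linarith

/-- Comparison of the expectations of Lipschitz functions under two measures, the first of which
has contracting heat-bath dynamics on `𝒢`. -/
lemma wExp_sub_le_of_contraction [Nonempty E] (h : HasOdds w r) (h' : HasOdds w' r')
    (hG : IsLowerSet 𝒢) (h0 : ∅ ∈ 𝒢) {θ A β : ℝ} (hθ0 : 0 < θ) (hθ1 : θ < 1)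
    (hθ : ∀ g σ, g ∉ σ → insert g σ ∈ 𝒢 →
      ∑ e ∈ Finset.univ.erase g, |upProb r e (insert g σ) - upProb r e σ| ≤ θ)
    (hA0 : 0 ≤ A) (hA : ∀ σ ∈ 𝒢, ∑ e, |upProb r e σ - upProb r' e σ| ≤ A)
    (hβ : badProb w 𝒢 ≤ β) (hβ' : badProb w' 𝒢 ≤ β)
    {f : Finset E → ℝ} (hf : FlipLipOn Set.univ 1 f) :
    wExp w f - wExp w' f ≤ (A + 7 * (Fintype.card E : ℝ) ^ 2 * β) / (1 - θ) := by
  set N : ℝ := (Fintype.card E : ℝ) with hN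
  have hN1 : 1 ≤ N := Nat.one_le_cast.2 (Fintype.card_pos (α := E))
  have hβ0 : 0 ≤ β := h.badProb_nonneg.trans hβ
  set 𝓢 : Set ℝ := {x | ∃ f, FlipLipOn Set.univ 1 f ∧ wExp w f - wExp w' f = x} with h𝓢
  have hne : 𝓢.Nonempty := ⟨_, fun _ => 0, fun _ _ _ => by simp, rfl⟩
  have hbdd : BddAbove 𝓢 := by
    refine ⟨2 * N, ?_⟩
    rintro _ ⟨f, hf, rfl⟩
    have h1 : wExp w f ≤ wExp w (fun _ => f ∅ + N) :=
      wExp_mono h.nonneg fun σ => by linarith [(abs_le.1 (hf.abs_sub_empty_le σ)).2]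
    have h2 : wExp w' (fun _ => f ∅ - N) ≤ wExp w' f :=
      wExp_mono h'.nonneg fun σ => by linarith [(abs_le.1 (hf.abs_sub_empty_le σ)).1]
    rw [wExp_const h.sum_pos] at h1
    rw [wExp_const h'.sum_pos] at h2
    linarith
  set W := sSup 𝓢 with hWdef
  have hW : ∀ f, FlipLipOn Set.univ 1 f → wExp w f - wExp w' f ≤ W :=
    fun f hf => le_csSup hbdd ⟨f, hf, rfl⟩
  have step : ∀ f, FlipLipOn Set.univ 1 f →
      N * (wExp w f - wExp w' f) ≤ (N - 1 + θ) * W + A + 7 * N ^ 2 * β := by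
    intro f₀ hf₀
    set f : Finset E → ℝ := fun σ => f₀ σ - f₀ ∅ with hfdef
    have hf : FlipLipOn Set.univ 1 f := fun e σ hs => by simpa [hfdef] using hf₀ e σ hs
    have hfb : ∀ σ, |f σ| ≤ N := fun σ => hf₀.abs_sub_empty_le σ
    have hfe : wExp w f₀ - wExp w' f₀ = wExp w f - wExp w' f := by
      rw [hfdef, wExp_sub f₀ (fun _ => f₀ ∅), wExp_sub f₀ (fun _ => f₀ ∅),
        wExp_const h.sum_pos, wExp_const h'.sum_pos]
      ring
    have hQb : ∀ σ, |glauber r f σ| ≤ N * N := by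
      intro σ
      refine (Finset.abs_sum_le_sum_abs _ _).trans ?_
      refine (Finset.sum_le_card_nsmul _ _ N fun e _ => ?_).trans ?_
      · have p0 := h.upProb_nonneg e σ
        have p1 := h.upProb_le_one e σ
        have h1 := abs_le.1 (hfb (σ.erase e))
        have h2 := abs_le.1 (hfb (insert e σ))
        rw [abs_le]
        constructor <;> nlinarith
      · rw [Finset.card_univ, nsmul_eq_mul]
    have h1 := wExp_sub_le_of_flipLipOn h h' hG h0 hβ hβ' hW (by linarith)
      (h.flipLipOn_glauber hθ0.le hθ hf) hQb
    have h2 : wExp w' (fun σ => glauber r f σ - glauber r' f σ) ≤ A + N * badProb w' 𝒢 := by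
      have hpt : ∀ σ, glauber r f σ - glauber r' f σ ≤ ∑ e, |upProb r e σ - upProb r' e σ| := by
        intro σ
        unfold glauber
        rw [← Finset.sum_sub_distrib]
        refine Finset.sum_le_sum fun e _ => ?_
        have h3 : |f (insert e σ) - f (σ.erase e)| ≤ 1 := by
          have := hf e (σ.erase e) trivial
          rwa [show insert e (σ.erase e) = insert e σ by
            ext x; simp only [Finset.mem_insert, Finset.mem_erase]; tauto] at this
        have h4 : f (σ.erase e) + upProb r e σ * (f (insert e σ) - f (σ.erase e)) -
            (f (σ.erase e) + upProb r' e σ * (f (insert e σ) - f (σ.erase e)))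
            = (upProb r e σ - upProb r' e σ) * (f (insert e σ) - f (σ.erase e)) := by ring
        rw [h4]
        refine (le_abs_self _).trans ?_
        rw [abs_mul]
        exact mul_le_of_le_one_right (abs_nonneg _) h3
      refine h'.wExp_le_of_good hA0 (fun σ hσ => (hpt σ).trans (hA σ hσ)) fun σ => ?_
      refine (hpt σ).trans ((Finset.sum_le_card_nsmul _ _ 1 fun e _ => ?_).trans ?_)
      · have p0 := h.upProb_nonneg e σ
        have p1 := h.upProb_le_one e σ
        have q0 := h'.upProb_nonneg e σ
        have q1 := h'.upProb_le_one e σ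
        rw [abs_le]; constructor <;> linarith
      · simp [hN]
    rw [wExp_sub] at h2
    rw [h.wExp_glauber] at h1
    rw [h'.wExp_glauber] at h2
    rw [hfe]
    have h5 := mul_le_mul_of_nonneg_left hβ' (by linarith : 0 ≤ N)
    have h6 : (N - 1 + θ) * N ≤ N * N := by nlinarith
    have h7 : N * β ≤ N ^ 2 * β := by nlinarith [mul_nonneg (by nlinarith : 0 ≤ N ^ 2 - N) hβ0]
    have h8 := mul_le_mul_of_nonneg_right h6 hβ0
    nlinarith
  have hWle : N * W ≤ (N - 1 + θ) * W + A + 7 * N ^ 2 * β := by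
    rw [← le_div_iff₀' (by linarith)]
    refine csSup_le hne ?_
    rintro _ ⟨f, hf, rfl⟩
    rw [le_div_iff₀' (by linarith)]
    exact step f hf
  refine (hW f hf).trans ?_
  rw [le_div_iff₀ (by linarith)]
  linarith

/-- Version of `wExp_sub_le_of_contraction` for functions that are Lipschitz on `𝒢` only. -/
lemma abs_wExp_sub_le_of_contraction [Nonempty E] (h : HasOdds w r) (h' : HasOdds w' r')
    (hG : IsLowerSet 𝒢) (h0 : ∅ ∈ 𝒢) {θ A β : ℝ} (hθ0 : 0 < θ) (hθ1 : θ < 1)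
    (hθ : ∀ g σ, g ∉ σ → insert g σ ∈ 𝒢 →
      ∑ e ∈ Finset.univ.erase g, |upProb r e (insert g σ) - upProb r e σ| ≤ θ)
    (hA0 : 0 ≤ A) (hA : ∀ σ ∈ 𝒢, ∑ e, |upProb r e σ - upProb r' e σ| ≤ A)
    (hβ : badProb w 𝒢 ≤ β) (hβ' : badProb w' 𝒢 ≤ β)
    {K M : ℝ} (hK : 0 < K) {f : Finset E → ℝ} (hf : FlipLipOn 𝒢 K f) (hM : ∀ σ, |f σ| ≤ M) :
    |wExp w f - wExp w' f| ≤ K * ((A + 7 * (Fintype.card E : ℝ) ^ 2 * β) / (1 - θ))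
      + 2 * (2 * M + K * Fintype.card E) * β := by
  have hW := fun f hf => wExp_sub_le_of_contraction h h' hG h0 hθ0 hθ1 hθ hA0 hA hβ hβ' (f := f) hf
  have h1 := wExp_sub_le_of_flipLipOn h h' hG h0 hβ hβ' hW hK hf hM
  have h2 := wExp_sub_le_of_flipLipOn h h' hG h0 hβ hβ' hW hK (f := fun σ => -f σ)
    (fun e σ hs => by rw [← neg_sub', abs_neg]; exact hf e σ hs) fun σ => by
      rw [abs_neg]; exact hM σ
  rw [wExp_neg, wExp_neg] at h2
  rw [abs_le]; constructor <;> linarith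

end Transport

section Laplace

variable {w : Finset E → ℝ} {r : E → Finset E → ℝ}

lemma HasOdds.tilt (h : HasOdds w r) (F : Finset E → ℝ) (t : ℝ) :
    HasOdds (fun σ => w σ * Real.exp (t * F σ))
      (fun e σ => r e σ * Real.exp (t * (F (insert e σ) - F (σ.erase e)))) where
  nonneg σ := mul_nonneg (h.nonneg σ) (Real.exp_pos _).le
  pos := mul_pos h.pos (Real.exp_pos _)
  odds_nonneg e σ := mul_nonneg (h.odds_nonneg e σ) (Real.exp_pos _).le
  weight_insert e σ he := by
    rw [h.weight_insert e σ he, Finset.erase_eq_of_notMem he]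
    have : Real.exp (t * F (insert e σ))
        = Real.exp (t * (F (insert e σ) - F σ)) * Real.exp (t * F σ) := by
      rw [← Real.exp_add]; ring_nf
    rw [this]; ring
  odds_insert e σ := by
    have : (insert e σ).erase e = σ.erase e := by
      ext x; simp only [Finset.mem_insert, Finset.mem_erase]; tauto
    rw [h.odds_insert, Finset.insert_idem, this]

lemma HasOdds.wExp_exp_le (h : HasOdds w r) (F : Finset E → ℝ) (t m : ℝ) :
    wExp w (fun σ => Real.exp (t * (F σ - m)))
      ≤ Real.exp (t * (wExp (fun σ => w σ * Real.exp (t * F σ)) F - m)) := by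
  set w' : Finset E → ℝ := fun σ => w σ * Real.exp (t * F σ) with hw'
  have h' : HasOdds w' _ := h.tilt F t
  set a := wExp w' F with ha
  have hZ := h.sum_pos
  have hZ' := h'.sum_pos
  have hJ : Real.exp (-t * a) ≤ wExp w' (fun σ => Real.exp (-t * F σ)) := by
    calc Real.exp (-t * a)
        = wExp w' (fun σ => Real.exp (-t * a) * (1 + t * a) + Real.exp (-t * a) * -t * F σ) := by
          rw [wExp_add, wExp_const h'.sum_pos, wExp_const_mul, ← ha]; ring
      _ ≤ _ := by
          refine wExp_mono h'.nonneg fun σ => ?_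
          have := Real.add_one_le_exp (-t * F σ - -t * a)
          calc _ = Real.exp (-t * a) * (-t * F σ - -t * a + 1) := by ring
            _ ≤ Real.exp (-t * a) * Real.exp (-t * F σ - -t * a) := by gcongr
            _ = _ := by rw [← Real.exp_add]; ring_nf
  have h1 : wExp w' (fun σ => Real.exp (-t * F σ)) = (∑ σ, w σ) / ∑ σ, w' σ := by
    unfold wExp
    congr 1
    refine Finset.sum_congr rfl fun σ _ => ?_
    rw [hw', mul_left_comm, ← Real.exp_add]
    simp
  have h2 : wExp w (fun σ => Real.exp (t * (F σ - m)))
      = Real.exp (-t * m) * ((∑ σ, w' σ) / ∑ σ, w σ) := by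
    rw [← mul_div_assoc, Finset.mul_sum]
    unfold wExp
    congr 1
    refine Finset.sum_congr rfl fun σ _ => ?_
    rw [hw', mul_left_comm, ← Real.exp_add]
    ring_nf
  rw [h1, le_div_iff₀ hZ'] at hJ
  rw [h2]
  calc _ ≤ Real.exp (-t * m) * Real.exp (t * a) := by
        gcongr
        rw [div_le_iff₀ hZ]
        calc ∑ σ, w' σ = Real.exp (t * a) * (Real.exp (-t * a) * ∑ σ, w' σ) := by
              rw [← mul_assoc, ← Real.exp_add]; simp
          _ ≤ _ := by gcongr
    _ = _ := by rw [← Real.exp_add]; ring_nf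

/-- Concentration from a comparison with the two tilted measures. -/
lemma HasOdds.tail_of_tilt (h : HasOdds w r) (F : Finset E → ℝ) {τ R : ℝ} (hτ : 0 ≤ τ) (s : ℝ)
    (hR : ∀ t, |t| = τ → |wExp w F - wExp (fun σ => w σ * Real.exp (t * F σ)) F| ≤ R) :
    wExp w (fun σ => if |F σ - wExp w F| ≤ s then 0 else 1)
      ≤ 2 * Real.exp (-(τ * s) + τ * R) := by
  set m := wExp w F with hm
  have key : ∀ t, |t| = τ → wExp w (fun σ => Real.exp (t * (F σ - m))) ≤ Real.exp (τ * R) := by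
    intro t ht
    refine (h.wExp_exp_le F t m).trans (Real.exp_le_exp.2 ?_)
    refine (le_abs_self _).trans ?_
    rw [abs_mul, ht, abs_sub_comm]
    exact mul_le_mul_of_nonneg_left (hR t ht) hτ
  have h1 := key τ (abs_of_nonneg hτ)
  have h2 := key (-τ) (by rw [abs_neg, abs_of_nonneg hτ])
  calc _ ≤ wExp w (fun σ => Real.exp (-(τ * s)) * (Real.exp (τ * (F σ - m))
          + Real.exp (-τ * (F σ - m)))) := by
        refine wExp_mono h.nonneg fun σ => ?_
        split_ifs with hs
        · positivity
        · rw [mul_add, ← Real.exp_add, ← Real.exp_add]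
          rcases lt_abs.1 (not_le.1 hs) with hs | hs
          · have : 1 ≤ Real.exp (-(τ * s) + τ * (F σ - m)) := Real.one_le_exp (by nlinarith)
            have := Real.exp_pos (-(τ * s) + -τ * (F σ - m))
            linarith
          · have : 1 ≤ Real.exp (-(τ * s) + -τ * (F σ - m)) := Real.one_le_exp (by nlinarith)
            have := Real.exp_pos (-(τ * s) + τ * (F σ - m))
            linarith
    _ = Real.exp (-(τ * s)) * (wExp w (fun σ => Real.exp (τ * (F σ - m)))
          + wExp w (fun σ => Real.exp (-τ * (F σ - m)))) := by
        rw [wExp_const_mul, wExp_add]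
    _ ≤ Real.exp (-(τ * s)) * (Real.exp (τ * R) + Real.exp (τ * R)) := by gcongr
    _ = _ := by rw [Real.exp_add]; ring

lemma abs_upProb_sub_le {r r' : E → Finset E → ℝ} {e : E} {σ τ : Finset E} (h : 0 ≤ r e σ)
    (h' : 0 ≤ r' e τ) : |upProb r e σ - upProb r' e τ| ≤ |r e σ - r' e τ| := by
  unfold upProb
  generalize r e σ = a at *
  generalize r' e τ = b at *
  have : a / (1 + a) - b / (1 + b) = (a - b) / ((1 + a) * (1 + b)) := by
    field_simp; ring
  rw [this, abs_div, abs_of_pos (by positivity : 0 < (1 + a) * (1 + b))]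
  exact div_le_self (abs_nonneg _) (by nlinarith [mul_nonneg h h'])

end Laplace

/-! ### Systems whose interactions are given by a linear 3-uniform hypergraph -/

section Hypergraph

/-- Number of triples of `𝒯` contained in `σ`. -/
def tripleCount (𝒯 : Finset (Finset E)) (σ : Finset E) : ℕ := (𝒯.filter (· ⊆ σ)).card

/-- Number of triples of `𝒯` that `e` completes in `σ`. -/
def linkCount (𝒯 : Finset (Finset E)) (e : E) (σ : Finset E) : ℕ :=
  (𝒯.filter fun t => e ∈ t ∧ t.erase e ⊆ σ).card

/-- The elements that lie in a common triple with `g`. -/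
def nbrs (𝒯 : Finset (Finset E)) (g : E) : Finset E :=
  Finset.univ.filter fun h => h ≠ g ∧ ∃ t ∈ 𝒯, g ∈ t ∧ h ∈ t

/-- The measure giving weight `l` to every element and `q` to every triple. -/
def tripleWeight (𝒯 : Finset (Finset E)) (l q : ℝ) (σ : Finset E) : ℝ :=
  l ^ σ.card * q ^ tripleCount 𝒯 σ

/-- Any two members of the 3-uniform family `𝒯` share at most one element. -/
structure IsLinearTriples (𝒯 : Finset (Finset E)) : Prop where
  card_eq : ∀ t ∈ 𝒯, t.card = 3
  eq_of_mem : ∀ t ∈ 𝒯, ∀ t' ∈ 𝒯, ∀ a b, a ≠ b → a ∈ t → b ∈ t → a ∈ t' → b ∈ t' → t = t'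

/-- Configurations in which every neighbourhood contains at most `T` elements. -/
def sparse (𝒯 : Finset (Finset E)) (T : ℝ) : Set (Finset E) :=
  {σ | ∀ g, ((σ ∩ nbrs 𝒯 g).card : ℝ) ≤ T}

variable {𝒯 : Finset (Finset E)}

lemma isLowerSet_sparse (T : ℝ) : IsLowerSet (sparse 𝒯 T) := by
  intro σ τ hτσ hσ g
  refine le_trans ?_ (hσ g)
  exact_mod_cast Finset.card_le_card (Finset.inter_subset_inter_right hτσ)

lemma empty_mem_sparse {T : ℝ} (hT : 0 ≤ T) : ∅ ∈ sparse 𝒯 T := by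
  intro g; simpa using hT

lemma linkCount_insert (e : E) (σ : Finset E) :
    linkCount 𝒯 e (insert e σ) = linkCount 𝒯 e σ := by
  unfold linkCount
  congr 1
  refine Finset.filter_congr fun t _ => and_congr_right fun _ => ?_
  rw [Finset.subset_insert_iff, Finset.erase_idem]

lemma tripleCount_insert {e : E} {σ : Finset E} (he : e ∉ σ) :
    tripleCount 𝒯 (insert e σ) = tripleCount 𝒯 σ + linkCount 𝒯 e σ := by
  unfold tripleCount linkCount
  rw [← Finset.card_union_of_disjoint]
  · congr 1
    ext t
    simp only [Finset.mem_filter, Finset.mem_union, Finset.subset_insert_iff]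
    by_cases het : e ∈ t
    · simp only [het, true_and]
      constructor
      · exact fun h => Or.inr h
      · rintro (h | h)
        · exact absurd (h.2 het) he
        · exact h
    · simp [het]
  · rw [Finset.disjoint_left]
    intro t h1 h2
    simp only [Finset.mem_filter] at h1 h2
    exact he (h1.2 h2.2.1)

lemma tripleCount_insert_sub_erase (e : E) (σ : Finset E) :
    (tripleCount 𝒯 (insert e σ) : ℝ) - tripleCount 𝒯 (σ.erase e) = linkCount 𝒯 e σ := by
  have h1 : insert e σ = insert e (σ.erase e) := by
    ext x; simp only [Finset.mem_insert, Finset.mem_erase]; tauto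
  rw [← linkCount_insert e σ, h1, linkCount_insert,
    tripleCount_insert (Finset.notMem_erase e σ)]
  push_cast; ring

lemma IsLinearTriples.tripleCount_empty (h𝒯 : IsLinearTriples 𝒯) : tripleCount 𝒯 ∅ = 0 := by
  unfold tripleCount
  rw [Finset.card_eq_zero, Finset.filter_eq_empty_iff]
  intro t ht h
  have := h𝒯.card_eq t ht
  rw [Finset.subset_empty.1 h] at this
  simp at this

lemma IsLinearTriples.hasOdds (h𝒯 : IsLinearTriples 𝒯) {l q : ℝ} (hl : 0 ≤ l) (hq : 0 ≤ q) :
    HasOdds (tripleWeight 𝒯 l q) (fun e σ => l * q ^ linkCount 𝒯 e σ) where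
  nonneg σ := by unfold tripleWeight; positivity
  pos := by simp [tripleWeight, h𝒯.tripleCount_empty]
  odds_nonneg e σ := by positivity
  weight_insert e σ he := by
    unfold tripleWeight
    rw [tripleCount_insert he, Finset.card_insert_of_notMem he, pow_succ, pow_add]; ring
  odds_insert e σ := by rw [linkCount_insert]

lemma IsLinearTriples.linkCount_le (h𝒯 : IsLinearTriples 𝒯) (e : E) (σ : Finset E) :
    linkCount 𝒯 e σ ≤ (σ ∩ nbrs 𝒯 e).card := by
  have hex : ∀ t ∈ 𝒯.filter (fun t => e ∈ t ∧ t.erase e ⊆ σ), ∃ x, x ∈ t.erase e := by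
    intro t ht
    simp only [Finset.mem_filter] at ht
    have := h𝒯.card_eq t ht.1
    refine Finset.card_pos.1 ?_
    rw [Finset.card_erase_of_mem ht.2.1]; omega
  have : Nonempty E := ⟨e⟩
  choose! ρ hρ using hex
  refine Finset.card_le_card_of_injOn ρ (fun t ht => ?_) fun t ht t' ht' hρt => ?_
  · have h1 := hρ t ht
    have h2 := (Finset.mem_filter.1 ht)
    simp only [Finset.coe_inter, Set.mem_inter_iff, Finset.mem_coe, nbrs, Finset.mem_filter,
      Finset.mem_univ, true_and]
    exact ⟨h2.2.2 h1, (Finset.mem_erase.1 h1).1, t, h2.1, h2.2.1, (Finset.mem_erase.1 h1).2⟩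
  · have h1 := Finset.mem_erase.1 (hρ t ht)
    have h1' := Finset.mem_erase.1 (hρ t' ht')
    have h2 := (Finset.mem_filter.1 ht)
    have h2' := (Finset.mem_filter.1 ht')
    rw [← hρt] at h1'
    exact h𝒯.eq_of_mem t h2.1 t' h2'.1 _ _ h1.1 h1.2 h2.2.1 h1'.2 h2'.2.1

lemma linkCount_mono (e : E) {σ τ : Finset E} (h : σ ⊆ τ) :
    linkCount 𝒯 e σ ≤ linkCount 𝒯 e τ := by
  refine Finset.card_le_card fun t ht => ?_
  simp only [Finset.mem_filter] at ht ⊢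
  exact ⟨ht.1, ht.2.1, ht.2.2.trans h⟩

/-- Total influence of the element `g` on the other elements. -/
lemma IsLinearTriples.sum_linkCount_insert_le (h𝒯 : IsLinearTriples 𝒯) (g : E) (σ : Finset E) :
    ∑ e ∈ Finset.univ.erase g, linkCount 𝒯 e (insert g σ)
      ≤ ∑ e ∈ Finset.univ.erase g, linkCount 𝒯 e σ + (σ ∩ nbrs 𝒯 g).card := by
  let S : E → Finset (Finset E) := fun e =>
    𝒯.filter fun t => e ∈ t ∧ g ∈ t ∧ (t.erase e).erase g ⊆ σ
  have h1 : ∀ e, linkCount 𝒯 e (insert g σ) ≤ linkCount 𝒯 e σ + (S e).card := by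
    intro e
    unfold linkCount
    refine (Finset.card_le_card fun t ht => ?_).trans (Finset.card_union_le _ _)
    simp only [S, Finset.mem_filter, Finset.mem_union, Finset.subset_insert_iff] at ht ⊢
    by_cases hg : g ∈ t
    · exact Or.inr ⟨ht.1, ht.2.1, hg, ht.2.2⟩
    · refine Or.inl ⟨ht.1, ht.2.1, ?_⟩
      have := ht.2.2
      rwa [Finset.erase_eq_of_notMem fun h => hg (Finset.mem_of_mem_erase h)] at this
  refine (Finset.sum_le_sum fun e _ => h1 e).trans ?_
  rw [Finset.sum_add_distrib]
  gcongr
  rw [← Finset.card_sigma]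
  have hmem : ∀ p ∈ (Finset.univ.erase g).sigma S, p.1 ≠ g ∧ p.2 ∈ 𝒯 ∧ p.1 ∈ p.2 ∧ g ∈ p.2 ∧
      (p.2.erase p.1).erase g ⊆ σ := by
    intro p hp
    simpa [S] using hp
  have hex : ∀ p ∈ (Finset.univ.erase g).sigma S, ∃ x, x ∈ (p.2.erase p.1).erase g := by
    intro p hp
    obtain ⟨h1, h2, h3, h4, h5⟩ := hmem p hp
    have := h𝒯.card_eq _ h2
    refine Finset.card_pos.1 ?_
    rw [Finset.card_erase_of_mem (Finset.mem_erase.2 ⟨h1.symm, h4⟩), Finset.card_erase_of_mem h3]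
    omega
  have : Nonempty E := ⟨g⟩
  choose! ρ hρ using hex
  refine Finset.card_le_card_of_injOn ρ (fun p hp => ?_) fun p hp p' hp' hpp => ?_
  · obtain ⟨h1, h2, h3, h4, h5⟩ := hmem p hp
    have h6 := hρ p hp
    have h7 := h5 h6
    simp only [Finset.mem_erase] at h6
    simp only [Finset.coe_inter, Set.mem_inter_iff, Finset.mem_coe, nbrs, Finset.mem_filter,
      Finset.mem_univ, true_and]
    exact ⟨h7, h6.1, p.2, h2, h4, h6.2.2⟩
  · obtain ⟨h1, h2, h3, h4, h5⟩ := hmem p hp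
    obtain ⟨h1', h2', h3', h4', h5'⟩ := hmem p' hp'
    have h6 := hρ p hp
    have h6' := hρ p' hp'
    simp only [Finset.mem_erase, ← hpp] at h6 h6'
    have ht : p.2 = p'.2 := h𝒯.eq_of_mem _ h2 _ h2' _ _ h6.1 h6.2.2 h4 h6'.2.2 h4'
    have he : p.1 = p'.1 := by
      by_contra hne
      have hsub : ({g, ρ p, p.1, p'.1} : Finset E) ⊆ p.2 := by
        intro x hx
        simp only [Finset.mem_insert, Finset.mem_singleton] at hx
        rcases hx with rfl | rfl | rfl | rfl
        · exact h4
        · exact h6.2.2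
        · exact h3
        · rw [ht]; exact h3'
      have hc := Finset.card_le_card hsub
      rw [h𝒯.card_eq _ h2, Finset.card_insert_of_notMem, Finset.card_insert_of_notMem,
        Finset.card_pair hne] at hc
      · omega
      · simp only [Finset.mem_insert, Finset.mem_singleton, not_or]
        exact ⟨h6.2.1, h6'.2.1⟩
      · simp only [Finset.mem_insert, Finset.mem_singleton, not_or]
        exact ⟨h6.1.symm, h1.symm, h1'.symm⟩
    exact Sigma.ext he (heq_of_eq ht)

lemma abs_pow_sub_pow_le_one_sub_mul {q : ℝ} (hq0 : 0 ≤ q) (hq1 : q ≤ 1) {k k' : ℕ} (h : k ≤ k') :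
    |q ^ k' - q ^ k| ≤ (1 - q) * ((k' : ℝ) - k) := by
  obtain ⟨j, rfl⟩ := Nat.exists_eq_add_of_le h
  have h1 := one_add_mul_le_pow (show (-2 : ℝ) ≤ q - 1 by linarith) j
  rw [add_sub_cancel] at h1
  have h2 : q ^ k ≤ 1 := pow_le_one₀ hq0 hq1
  have h3 : q ^ j ≤ 1 := pow_le_one₀ hq0 hq1
  have h4 : 0 ≤ q ^ k := pow_nonneg hq0 k
  rw [pow_add, abs_sub_comm, abs_of_nonneg (by nlinarith)]
  push_cast
  nlinarith


lemma sum_abs_upProb_sub_le (h𝒯 : IsLinearTriples 𝒯) {l q T : ℝ} (hl : 0 ≤ l) (hq0 : 0 ≤ q)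
    (hq1 : q ≤ 1) {g : E} {σ : Finset E} (hσ : σ ∈ sparse 𝒯 T) :
    ∑ e ∈ Finset.univ.erase g, |upProb (fun e σ => l * q ^ linkCount 𝒯 e σ) e (insert g σ)
      - upProb (fun e σ => l * q ^ linkCount 𝒯 e σ) e σ| ≤ l * (1 - q) * T := by
  have hsum : ((∑ e ∈ Finset.univ.erase g, linkCount 𝒯 e (insert g σ) : ℕ) : ℝ)
      ≤ (∑ e ∈ Finset.univ.erase g, linkCount 𝒯 e σ : ℕ) + T := by
    refine le_trans ?_ (add_le_add_right (hσ g) _)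
    exact_mod_cast h𝒯.sum_linkCount_insert_le g σ
  push_cast at hsum
  calc _ ≤ ∑ e ∈ Finset.univ.erase g,
          l * (1 - q) * ((linkCount 𝒯 e (insert g σ) : ℝ) - linkCount 𝒯 e σ) := by
        refine Finset.sum_le_sum fun e _ => ?_
        refine (abs_upProb_sub_le (by positivity) (by positivity)).trans ?_
        rw [← mul_sub, abs_mul, abs_of_nonneg hl, mul_assoc]
        exact mul_le_mul_of_nonneg_left (abs_pow_sub_pow_le_one_sub_mul hq0 hq1
          (linkCount_mono e (Finset.subset_insert g σ))) hl
    _ ≤ _ := by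
        rw [← Finset.mul_sum, Finset.sum_sub_distrib]
        exact mul_le_mul_of_nonneg_left (by linarith) (mul_nonneg hl (by linarith))

lemma badProb_sparse_le {w : Finset E → ℝ} {r : E → Finset E → ℝ} (h : HasOdds w r) {l : ℝ}
    (hr : ∀ e σ, r e σ ≤ l) (hl : 0 ≤ l) {s : ℝ} (hs : 0 ≤ s) {M T : ℝ}
    (hM : ∀ g, ((nbrs 𝒯 g).card : ℝ) ≤ M) :
    badProb w (sparse 𝒯 T)
      ≤ Fintype.card E * Real.exp (-(s * T) + M * ((Real.exp s - 1) * l)) := by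
  calc badProb w (sparse 𝒯 T)
      ≤ wExp w (fun σ => ∑ g, if T < ((σ ∩ nbrs 𝒯 g).card : ℝ) then 1 else 0) := by
        refine wExp_mono h.nonneg fun σ => ?_
        have h0 : ∀ g ∈ Finset.univ,
            (0 : ℝ) ≤ if T < ((σ ∩ nbrs 𝒯 g).card : ℝ) then 1 else 0 := by
          intro g _; split_ifs <;> norm_num
        split_ifs with hσ
        · exact Finset.sum_nonneg h0
        · simp only [sparse, Set.mem_ofPred_eq, not_forall, not_le] at hσ
          obtain ⟨g, hg⟩ := hσ
          refine le_trans ?_ (Finset.single_le_sum h0 (Finset.mem_univ g))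
          rw [if_pos hg]
    _ = ∑ g, wExp w (fun σ => if T < ((σ ∩ nbrs 𝒯 g).card : ℝ) then 1 else 0) := wExp_sum _ _
    _ ≤ ∑ _g : E, Real.exp (-(s * T) + M * ((Real.exp s - 1) * l)) :=
        Finset.sum_le_sum fun g _ => h.tail_card_inter hr hl hs _ (hM g)
    _ = _ := by simp

lemma abs_exp_sub_one_le_exp_abs_sub_one (x : ℝ) : |Real.exp x - 1| ≤ Real.exp |x| - 1 := by
  rcases le_total 0 x with hx | hx
  · rw [abs_of_nonneg hx, abs_of_nonneg (by linarith [Real.add_one_le_exp x])]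
  · rw [abs_of_nonpos hx, abs_of_nonpos (by linarith [Real.exp_le_one_iff.2 hx])]
    have h : Real.exp x * Real.exp (-x) = 1 := by rw [← Real.exp_add]; simp
    have := Real.exp_pos x
    have := Real.exp_pos (-x)
    nlinarith [sq_nonneg (Real.exp x - 1)]

/-- General concentration inequality for an increasing function `F`. -/
lemma tail_of_increments [Nonempty E] (h𝒯 : IsLinearTriples 𝒯) {l q T M s β τ : ℝ}
    (hl : 0 < l) (hq0 : 0 ≤ q) (hq1 : q < 1) (hT : 0 < T) (hθ : l * (1 - q) * T < 1)
    (hM : ∀ g, ((nbrs 𝒯 g).card : ℝ) ≤ M) (hs : 0 ≤ s) (hτ : 0 ≤ τ)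
    (hβ : Fintype.card E * Real.exp (-(s * T) + M * ((Real.exp s - 1) * (l * Real.exp τ))) ≤ β)
    {F : Finset E → ℝ} {K A B : ℝ} (hK : 0 < K) (hA0 : 0 ≤ A)
    (hF : ∀ e σ, 0 ≤ F (insert e σ) - F (σ.erase e))
    (hodds : ∀ e σ t, |t| = τ → q ^ linkCount 𝒯 e σ *
      Real.exp (t * (F (insert e σ) - F (σ.erase e))) ≤ Real.exp τ)
    (hA : ∀ σ ∈ sparse 𝒯 T,
      ∑ e, (Real.exp (τ * (F (insert e σ) - F (σ.erase e))) - 1) ≤ A)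
    (hFK : FlipLipOn (sparse 𝒯 T) K F) (hB : ∀ σ, |F σ| ≤ B) (a : ℝ) :
    wExp (tripleWeight 𝒯 l q)
        (fun σ => if |F σ - wExp (tripleWeight 𝒯 l q) F| ≤ a then 0 else 1)
      ≤ 2 * Real.exp (-(τ * a) + τ * (K * ((l * A + 7 * (Fintype.card E : ℝ) ^ 2 * β)
          / (1 - l * (1 - q) * T)) + 2 * (2 * B + K * Fintype.card E) * β)) := by
  have h := h𝒯.hasOdds hl.le hq0
  have hl' : l ≤ l * Real.exp τ := le_mul_of_one_le_right hl.le (Real.one_le_exp hτ)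
  refine h.tail_of_tilt F hτ a fun t ht => ?_
  have h' := h.tilt F t
  refine abs_wExp_sub_le_of_contraction h h' (isLowerSet_sparse T) (empty_mem_sparse hT.le)
    (mul_pos (mul_pos hl (by linarith)) hT) hθ (fun g σ _ hG => ?_) (by positivity)
    (fun σ hσ => ?_) ?_ ?_ hK hFK hB
  · exact sum_abs_upProb_sub_le h𝒯 hl.le hq0 hq1.le
      (isLowerSet_sparse T (Finset.subset_insert g σ) hG)
  · refine le_trans ?_ (mul_le_mul_of_nonneg_left (hA σ hσ) hl.le)
    rw [Finset.mul_sum]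
    refine Finset.sum_le_sum fun e _ => ?_
    refine (abs_upProb_sub_le (h.odds_nonneg e σ) (h'.odds_nonneg e σ)).trans ?_
    have hq : q ^ linkCount 𝒯 e σ ≤ 1 := pow_le_one₀ hq0 hq1.le
    have h1 := abs_exp_sub_one_le_exp_abs_sub_one (t * (F (insert e σ) - F (σ.erase e)))
    rw [abs_mul, ht, abs_of_nonneg (hF e σ)] at h1
    calc _ = l * (q ^ linkCount 𝒯 e σ
            * |Real.exp (t * (F (insert e σ) - F (σ.erase e))) - 1|) := by
          rw [abs_sub_comm, ← mul_sub_one, abs_mul, abs_of_nonneg (h.odds_nonneg e σ), mul_assoc]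
      _ ≤ l * (1 * (Real.exp (τ * (F (insert e σ) - F (σ.erase e))) - 1)) := by gcongr
      _ = _ := by rw [one_mul]
  · refine (badProb_sparse_le h (fun e σ => ?_) (hl.le.trans hl') hs hM).trans hβ
    exact (mul_le_of_le_one_right hl.le (pow_le_one₀ hq0 hq1.le)).trans hl'
  · refine (badProb_sparse_le h' (fun e σ => ?_) (hl.le.trans hl') hs hM).trans hβ
    rw [mul_assoc]
    exact mul_le_mul_of_nonneg_left (hodds e σ t ht) hl.le

/-- Concentration of the number of elements in `S`. -/
lemma tail_card [Nonempty E] (h𝒯 : IsLinearTriples 𝒯) {l q T M s β τ : ℝ}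
    (hl : 0 < l) (hq0 : 0 ≤ q) (hq1 : q < 1) (hT : 0 < T) (hθ : l * (1 - q) * T < 1)
    (hM : ∀ g, ((nbrs 𝒯 g).card : ℝ) ≤ M) (hs : 0 ≤ s) (hτ : 0 ≤ τ)
    (hβ : Fintype.card E * Real.exp (-(s * T) + M * ((Real.exp s - 1) * (l * Real.exp τ))) ≤ β)
    (S : Finset E) (a : ℝ) :
    wExp (tripleWeight 𝒯 l q) (fun σ => if |((σ ∩ S).card : ℝ)
        - wExp (tripleWeight 𝒯 l q) (fun σ => ((σ ∩ S).card : ℝ))| ≤ a then 0 else 1)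
      ≤ 2 * Real.exp (-(τ * a) + τ * (1 * ((l * (S.card * (Real.exp τ - 1))
          + 7 * (Fintype.card E : ℝ) ^ 2 * β) / (1 - l * (1 - q) * T))
          + 2 * (2 * Fintype.card E + 1 * Fintype.card E) * β)) := by
  have hinc : ∀ (e : E) (σ : Finset E), (((insert e σ) ∩ S).card : ℝ) - ((σ.erase e) ∩ S).card
      = if e ∈ S then 1 else 0 := by
    intro e σ
    rw [Finset.erase_inter]
    split_ifs with he
    · have : insert e σ ∩ S = insert e ((σ ∩ S).erase e) := by
        ext x
        by_cases hx : x = e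
        · simp [hx, he]
        · simp [hx]
      rw [this, Finset.card_insert_of_notMem (Finset.notMem_erase _ _)]
      push_cast; ring
    · rw [Finset.insert_inter_of_notMem he, Finset.erase_eq_of_notMem (by simp [he]), sub_self]
  have hexp : 0 ≤ Real.exp τ - 1 := by linarith [Real.one_le_exp hτ]
  refine tail_of_increments h𝒯 hl hq0 hq1 hT hθ hM hs hτ hβ one_pos (by positivity)
    (fun e σ => ?_) (fun e σ t ht => ?_) (fun σ _ => ?_) (fun e σ _ => ?_) (fun σ => ?_) a
  · rw [hinc]; split_ifs <;> norm_num
  · rw [hinc]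
    refine (mul_le_of_le_one_left (Real.exp_pos _).le (pow_le_one₀ hq0 hq1.le)).trans ?_
    refine Real.exp_le_exp.2 ?_
    split_ifs
    · rw [mul_one, ← ht]; exact le_abs_self t
    · simpa using hτ
  · simp only [hinc]
    have : ∀ e, Real.exp (τ * if e ∈ S then 1 else 0) - 1
        = if e ∈ S then Real.exp τ - 1 else 0 := fun e => by split_ifs <;> simp
    simp only [this, Finset.sum_ite_mem, Finset.univ_inter, Finset.sum_const, nsmul_eq_mul, le_refl]
  · by_cases he : e ∈ σ
    · simp [Finset.insert_eq_of_mem he]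
    · have := hinc e σ
      rw [Finset.erase_eq_of_notMem he] at this
      rw [this]; split_ifs <;> norm_num
  · rw [abs_of_nonneg (by positivity)]
    exact_mod_cast Finset.card_le_univ _

/-- Concentration of the number of triples. -/
lemma tail_tripleCount [Nonempty E] (h𝒯 : IsLinearTriples 𝒯) {l q T M s β τ : ℝ}
    (hl : 0 < l) (hq0 : 0 ≤ q) (hq1 : q < 1) (hT : 0 < T) (hθ : l * (1 - q) * T < 1)
    (hM : ∀ g, ((nbrs 𝒯 g).card : ℝ) ≤ M) (hs : 0 ≤ s) (hτ : 0 ≤ τ)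
    (hβ : Fintype.card E * Real.exp (-(s * T) + M * ((Real.exp s - 1) * (l * Real.exp τ))) ≤ β)
    (hqτ : q * Real.exp τ ≤ 1) (a : ℝ) :
    wExp (tripleWeight 𝒯 l q) (fun σ => if |(tripleCount 𝒯 σ : ℝ)
        - wExp (tripleWeight 𝒯 l q) (fun σ => (tripleCount 𝒯 σ : ℝ))| ≤ a then 0 else 1)
      ≤ 2 * Real.exp (-(τ * a) + τ * (T * ((l * (Fintype.card E * (Real.exp (τ * T) - 1))
          + 7 * (Fintype.card E : ℝ) ^ 2 * β) / (1 - l * (1 - q) * T))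
          + 2 * (2 * 𝒯.card + T * Fintype.card E) * β)) := by
  have hexp : 0 ≤ Real.exp (τ * T) - 1 := by
    linarith [Real.one_le_exp (mul_nonneg hτ hT.le)]
  have hlink : ∀ σ ∈ sparse 𝒯 T, ∀ e, (linkCount 𝒯 e σ : ℝ) ≤ T := fun σ hσ e =>
    le_trans (by exact_mod_cast h𝒯.linkCount_le e σ) (hσ e)
  refine tail_of_increments h𝒯 hl hq0 hq1 hT hθ hM hs hτ hβ hT (by positivity)
    (fun e σ => ?_) (fun e σ t ht => ?_) (fun σ hσ => ?_) (fun e σ hσ => ?_) (fun σ => ?_) a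
  · rw [tripleCount_insert_sub_erase]; positivity
  · rw [tripleCount_insert_sub_erase, mul_comm t, Real.exp_nat_mul, ← mul_pow]
    refine le_trans (pow_le_one₀ (by positivity) (le_trans ?_ hqτ)) (Real.one_le_exp hτ)
    gcongr
    rw [← ht]; exact le_abs_self t
  · simp only [tripleCount_insert_sub_erase]
    refine (Finset.sum_le_card_nsmul _ _ (Real.exp (τ * T) - 1) fun e _ => ?_).trans_eq
      (by rw [Finset.card_univ, nsmul_eq_mul])
    have := hlink σ hσ e
    gcongr
  · by_cases he : e ∈ σ
    · simp [Finset.insert_eq_of_mem he, hT.le]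
    · rw [tripleCount_insert he, Nat.cast_add, add_sub_cancel_left,
        abs_of_nonneg (by positivity), ← linkCount_insert]
      exact hlink _ hσ e
  · rw [abs_of_nonneg (by positivity)]
    exact_mod_cast Finset.card_le_card (Finset.filter_subset _ _)

end Hypergraph

end SpinSystem

section PairEncoding

variable {n : ℕ}

/-- The edges of the complete graph on `Fin n`. -/
abbrev Pair (n : ℕ) := {e : Sym2 (Fin n) // ¬ e.IsDiag}

/-- The graph whose edges are the given pairs. -/
def toGraph (σ : Finset (Pair n)) : SimpleGraph (Fin n) :=
  SimpleGraph.fromEdgeSet (Subtype.val '' (σ : Set (Pair n)))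

lemma mem_edgeSet_toGraph (σ : Finset (Pair n)) (e : Pair n) :
    e.1 ∈ (toGraph σ).edgeSet ↔ e ∈ σ := by
  rw [toGraph, SimpleGraph.edgeSet_fromEdgeSet]
  simp [e.2]

lemma edgeSet_toGraph (σ : Finset (Pair n)) :
    (toGraph σ).edgeSet = Subtype.val '' (σ : Set (Pair n)) := by
  ext e
  constructor
  · intro he
    exact ⟨⟨e, SimpleGraph.not_isDiag_of_mem_edgeSet _ he⟩,
      (mem_edgeSet_toGraph σ ⟨e, SimpleGraph.not_isDiag_of_mem_edgeSet _ he⟩).1 he, rfl⟩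
  · rintro ⟨e, he, rfl⟩
    exact (mem_edgeSet_toGraph σ e).2 he

lemma toGraph_bijective : Function.Bijective (toGraph : Finset (Pair n) → _) := by
  constructor
  · intro σ τ h
    ext e
    rw [← mem_edgeSet_toGraph, h, mem_edgeSet_toGraph]
  · intro G
    refine ⟨Finset.univ.filter fun e => e.1 ∈ G.edgeSet, ?_⟩
    rw [← SimpleGraph.edgeSet_inj, edgeSet_toGraph]
    ext e
    constructor
    · rintro ⟨e, he, rfl⟩
      simpa using he
    · intro he
      exact ⟨⟨e, SimpleGraph.not_isDiag_of_mem_edgeSet _ he⟩, by simpa using he, rfl⟩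

lemma edgeCount_toGraph (σ : Finset (Pair n)) : edgeCount (toGraph σ) = σ.card := by
  rw [edgeCount, edgeSet_toGraph, Nat.card_image_of_injective Subtype.val_injective]
  simp

/-- The pairs containing a given vertex. -/
def pairsAt (v : Fin n) : Finset (Pair n) := Finset.univ.filter fun e => v ∈ e.1

lemma mem_pairsAt {v : Fin n} {e : Pair n} : e ∈ pairsAt v ↔ v ∈ e.1 := by simp [pairsAt]

lemma degN_toGraph (σ : Finset (Pair n)) (v : Fin n) :
    degN (toGraph σ) v = (σ ∩ pairsAt v).card := by
  have h : (toGraph σ).incidenceSet v = Subtype.val '' ((σ ∩ pairsAt v : Finset (Pair n)) : Set (Pair n)) := by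
    ext e
    rw [SimpleGraph.incidenceSet, edgeSet_toGraph]
    simp only [Set.mem_image, Finset.mem_coe, Finset.mem_inter, mem_pairsAt]
    constructor
    · rintro ⟨⟨e, he, rfl⟩, hv⟩
      exact ⟨e, ⟨he, hv⟩, rfl⟩
    · rintro ⟨e, ⟨he, hv⟩, rfl⟩
      exact ⟨⟨e, he, rfl⟩, hv⟩
  rw [degN, ← Nat.card_congr ((toGraph σ).incidenceSetEquivNeighborSet v), h,
    Nat.card_image_of_injective Subtype.val_injective, Nat.card_coe_set_eq,
    Set.ncard_coe_finset]

lemma degN_le (G : SimpleGraph (Fin n)) (v : Fin n) : degN G v ≤ n :=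
  (Finite.card_subtype_le _).trans_eq (Nat.card_fin n)

lemma card_pairsAt_le (v : Fin n) : (pairsAt v).card ≤ n := by
  simpa [degN_toGraph] using degN_le (toGraph Finset.univ) v

lemma card_pair : Fintype.card (Pair n) = n.choose 2 := by
  rw [Sym2.card_subtype_not_diag, Fintype.card_fin]

/-- The pairs with both ends in `s`. -/
def pairsIn (s : Finset (Fin n)) : Finset (Pair n) := Finset.univ.filter fun e => ∀ v ∈ e.1, v ∈ s

/-- The edge sets of triangles. -/
def triples (n : ℕ) : Finset (Finset (Pair n)) :=
  (Finset.powersetCard 3 Finset.univ).image pairsIn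

lemma mk_mem_pairsIn {s : Finset (Fin n)} {u v : Fin n} (h : ¬ s(u, v).IsDiag) :
    (⟨s(u, v), h⟩ : Pair n) ∈ pairsIn s ↔ u ∈ s ∧ v ∈ s := by
  simp [pairsIn]

lemma isNClique_toGraph (σ : Finset (Pair n)) (s : Finset (Fin n)) :
    (toGraph σ).IsNClique 3 s ↔ s.card = 3 ∧ pairsIn s ⊆ σ := by
  rw [SimpleGraph.isNClique_iff, and_comm, SimpleGraph.isClique_iff]
  refine and_congr_right fun _ => ⟨?_, ?_⟩
  · rintro h ⟨e, he⟩ hes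
    induction e with
    | _ u v =>
      rw [mk_mem_pairsIn] at hes
      rw [← mem_edgeSet_toGraph]
      exact h hes.1 hes.2 (by simpa using he)
  · intro h u hu v hv huv
    have hd : ¬ s(u, v).IsDiag := by simpa using huv
    exact (mem_edgeSet_toGraph σ ⟨_, hd⟩).2 (h ((mk_mem_pairsIn hd).2 ⟨hu, hv⟩))

lemma pairsIn_injOn :
    Set.InjOn (pairsIn : Finset (Fin n) → _) {s | s.card = 3} := by
  have key : ∀ s t : Finset (Fin n), s.card = 3 → pairsIn s = pairsIn t → s ⊆ t := by
    intro s t hs h u hu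
    obtain ⟨v, hv, huv⟩ := Finset.exists_mem_ne (by omega : 1 < s.card) u
    have hd : ¬ s(u, v).IsDiag := by simpa using huv.symm
    have := (mk_mem_pairsIn hd).2 ⟨hu, hv⟩
    rw [h] at this
    exact ((mk_mem_pairsIn hd).1 this).1
  intro s hs t ht h
  exact (key s t hs h).antisymm (key t s ht h.symm)

lemma triCount_toGraph (σ : Finset (Pair n)) :
    triCount (toGraph σ) = tripleCount (triples n) σ := by
  have h : (triples n).filter (· ⊆ σ) =
      (Finset.univ.filter fun s : Finset (Fin n) => (toGraph σ).IsNClique 3 s).image pairsIn := by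
    ext t
    simp only [triples, Finset.mem_filter, Finset.mem_image, Finset.mem_powersetCard,
      Finset.mem_univ, true_and, isNClique_toGraph, Finset.subset_univ]
    constructor
    · rintro ⟨⟨s, hs, rfl⟩, h⟩
      exact ⟨s, ⟨hs, h⟩, rfl⟩
    · rintro ⟨s, ⟨hs, h⟩, rfl⟩
      exact ⟨⟨s, hs, rfl⟩, h⟩
  rw [tripleCount, h, Finset.card_image_of_injOn, triCount, Nat.card_eq_fintype_card,
    Fintype.card_subtype]
  intro s hs t ht
  simp only [Finset.coe_filter, Finset.mem_univ, true_and, isNClique_toGraph] at hs ht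
  exact pairsIn_injOn hs.1 ht.1

lemma card_pairsIn (s : Finset (Fin n)) : (pairsIn s).card = s.card.choose 2 := by
  rw [← Sym2.card_image_offDiag, ← Finset.card_map (Function.Embedding.subtype _)]
  congr 1
  ext e
  induction e with
  | _ u v =>
    simp only [Finset.mem_map, Function.Embedding.coe_subtype, Finset.mem_image,
      Finset.mem_offDiag, Prod.exists]
    constructor
    · rintro ⟨⟨e, hd⟩, he, rfl⟩
      rw [mk_mem_pairsIn] at he
      exact ⟨u, v, ⟨he.1, he.2, by simpa using hd⟩, rfl⟩
    · rintro ⟨a, b, ⟨ha, hb, hab⟩, h⟩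
      have hd : ¬ s(a, b).IsDiag := by simpa using hab
      exact ⟨⟨s(a, b), hd⟩, (mk_mem_pairsIn hd).2 ⟨ha, hb⟩, h⟩

lemma mem_pairsIn_iff (s : Finset (Fin n)) (e : Pair n) :
    e ∈ pairsIn s ↔ e.1.toFinset ⊆ s := by
  simp [pairsIn, Finset.subset_iff]

lemma isLinearTriples_triples : IsLinearTriples (triples n) := by
  constructor
  · intro t ht
    simp only [triples, Finset.mem_image, Finset.mem_powersetCard] at ht
    obtain ⟨s, ⟨-, hs⟩, rfl⟩ := ht
    rw [card_pairsIn, hs]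
    rfl
  · intro t ht t' ht' a b hab hat hbt hat' hbt'
    simp only [triples, Finset.mem_image, Finset.mem_powersetCard] at ht ht'
    obtain ⟨s, ⟨-, hs⟩, rfl⟩ := ht
    obtain ⟨s', ⟨-, hs'⟩, rfl⟩ := ht'
    rw [mem_pairsIn_iff] at hat hbt hat' hbt'
    have hcard : 3 ≤ (a.1.toFinset ∪ b.1.toFinset).card := by
      by_contra! hlt
      have ha := Sym2.card_toFinset_of_not_isDiag a.1 a.2
      have hb := Sym2.card_toFinset_of_not_isDiag b.1 b.2
      have h1 := Finset.eq_of_subset_of_card_le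
        (Finset.subset_union_left (s₁ := a.1.toFinset) (s₂ := b.1.toFinset)) (by omega)
      have h2 := Finset.eq_of_subset_of_card_le
        (Finset.subset_union_right (s₁ := a.1.toFinset) (s₂ := b.1.toFinset)) (by omega)
      refine hab (Subtype.ext (Sym2.ext fun x => ?_))
      rw [← Sym2.mem_toFinset, ← Sym2.mem_toFinset, h1.trans h2.symm]
    have h1 := Finset.eq_of_subset_of_card_le (Finset.union_subset hat hbt) (by omega)
    have h2 := Finset.eq_of_subset_of_card_le (Finset.union_subset hat' hbt') (by omega)
    rw [← h1, ← h2]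

lemma card_triples_le : (triples n).card ≤ n ^ 3 := by
  refine Finset.card_image_le.trans ?_
  rw [Finset.card_powersetCard, Finset.card_univ, Fintype.card_fin]
  exact Nat.choose_le_pow n 3

lemma card_nbrs_triples_le (g : Pair n) : (nbrs (triples n) g).card ≤ 2 * n := by
  obtain ⟨e, he⟩ := g
  induction e with
  | _ u v =>
    have hsub : nbrs (triples n) ⟨s(u, v), he⟩ ⊆ pairsAt u ∪ pairsAt v := by
      rintro ⟨h, hd⟩ hh
      simp only [nbrs, Finset.mem_filter, Finset.mem_univ, true_and, triples, Finset.mem_image,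
        Finset.mem_powersetCard] at hh
      obtain ⟨hne, t, ⟨s, ⟨-, hs⟩, rfl⟩, hg, hh⟩ := hh
      rw [mem_pairsIn_iff] at hg hh
      by_contra hcon
      simp only [mem_pairsAt, Finset.mem_union, not_or] at hcon
      have hdisj : Disjoint (s(u, v)).toFinset h.toFinset := by
        rw [Finset.disjoint_left]
        intro x hx hx'
        rw [Sym2.mem_toFinset] at hx hx'
        rw [Sym2.mem_iff] at hx
        rcases hx with rfl | rfl
        · exact hcon.1 hx'
        · exact hcon.2 hx'
      have hc := Finset.card_le_card (Finset.union_subset hg hh)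
      rw [Finset.card_union_of_disjoint hdisj, Sym2.card_toFinset_of_not_isDiag _ he,
        Sym2.card_toFinset_of_not_isDiag _ hd] at hc
      omega
    calc _ ≤ (pairsAt u ∪ pairsAt v).card := Finset.card_le_card hsub
      _ ≤ (pairsAt u).card + (pairsAt v).card := Finset.card_union_le _ _
      _ ≤ n + n := add_le_add (card_pairsAt_le u) (card_pairsAt_le v)
      _ = 2 * n := by ring

lemma nonempty_pair (hn : 2 ≤ n) : Nonempty (Pair n) := by
  rw [← Fintype.card_pos_iff, card_pair]
  exact Nat.choose_pos hn

lemma card_pair_le : Fintype.card (Pair n) ≤ n ^ 2 := by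
  rw [card_pair]
  exact Nat.choose_le_pow n 2

lemma edgeCount_eq_of_iso {G H : SimpleGraph (Fin n)} (φ : G ≃g H) : edgeCount G = edgeCount H :=
  Nat.card_congr φ.mapEdgeSet

lemma degN_eq_of_iso {G H : SimpleGraph (Fin n)} (φ : G ≃g H) (v : Fin n) :
    degN G v = degN H (φ v) :=
  Nat.card_congr (φ.mapNeighborSet v)

lemma triCount_le_of_iso {G H : SimpleGraph (Fin n)} (φ : G ≃g H) : triCount G ≤ triCount H := by
  refine Nat.card_le_card_of_injective
    (fun s => ⟨s.1.map φ.toEquiv.toEmbedding, ?_⟩) fun s t h => ?_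
  · rw [SimpleGraph.isNClique_iff, Finset.card_map]
    refine ⟨?_, s.2.card_eq⟩
    rw [SimpleGraph.isClique_iff, Finset.coe_map]
    rintro _ ⟨a, ha, rfl⟩ _ ⟨b, hb, rfl⟩ hab
    exact φ.map_rel_iff.2 (s.2.isClique ha hb fun h => hab (by rw [h]))
  · exact Subtype.ext (Finset.map_injective _ (Subtype.ext_iff.1 h))

lemma triCount_eq_of_iso {G H : SimpleGraph (Fin n)} (φ : G ≃g H) : triCount G = triCount H :=
  (triCount_le_of_iso φ).antisymm (triCount_le_of_iso φ.symm)

lemma gibbsExp_degN_eq (l ζ : ℝ) (u v : Fin n) :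
    gibbsExp n l ζ (fun G => (degN G u : ℝ)) = gibbsExp n l ζ (fun G => (degN G v : ℝ)) := by
  rw [gibbsExp, gibbsExp]
  congr 1
  refine Fintype.sum_equiv (Equiv.swap u v).simpleGraph _ _ fun G => ?_
  let φ : (Equiv.swap u v).simpleGraph G ≃g G := SimpleGraph.Iso.comap (Equiv.swap u v).symm G
  have hv : φ v = u := by
    change (Equiv.swap u v).symm v = u
    simp
  rw [gibbsWeight, gibbsWeight, edgeCount_eq_of_iso φ, triCount_eq_of_iso φ,
    degN_eq_of_iso φ v, hv]

lemma gibbsWeight_toGraph (l ζ : ℝ) (σ : Finset (Pair n)) :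
    gibbsWeight l ζ (toGraph σ) = tripleWeight (triples n) l (1 - ζ) σ := by
  rw [gibbsWeight, tripleWeight, edgeCount_toGraph, triCount_toGraph]

lemma gibbsExp_eq_wExp (l ζ : ℝ) (f : SimpleGraph (Fin n) → ℝ) :
    gibbsExp n l ζ f = wExp (tripleWeight (triples n) l (1 - ζ)) fun σ => f (toGraph σ) := by
  rw [gibbsExp, Zfun, wExp, ← toGraph_bijective.sum_comp, ← toGraph_bijective.sum_comp]
  simp only [gibbsWeight_toGraph]

lemma gibbsProb_eq_wExp (l ζ : ℝ) (A : Set (SimpleGraph (Fin n))) :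
    gibbsProb n l ζ A
      = wExp (tripleWeight (triples n) l (1 - ζ)) fun σ => if toGraph σ ∈ A then 1 else 0 := by
  rw [← gibbsExp_eq_wExp l ζ fun G => if G ∈ A then 1 else 0, gibbsProb, gibbsExp]
  simp only [ite_mul, one_mul, zero_mul]

/-- Union bound. -/
lemma one_sub_le_gibbsProb {ι : Type*} (I : Finset ι) {l ζ δ : ℝ} (hl : 0 ≤ l) (hζ : ζ ≤ 1)
    (P : ι → Finset (Pair n) → Prop) {A : Set (SimpleGraph (Fin n))}
    (hP : ∀ i ∈ I, wExp (tripleWeight (triples n) l (1 - ζ)) (fun σ => if P i σ then 0 else 1) ≤ δ)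
    (hA : ∀ σ, (∀ i ∈ I, P i σ) → toGraph σ ∈ A) :
    1 - I.card * δ ≤ gibbsProb n l ζ A := by
  set w := tripleWeight (triples n) l (1 - ζ)
  have hw := isLinearTriples_triples.hasOdds hl (sub_nonneg.2 hζ) (𝒯 := triples n)
  have hsum : wExp w (fun σ => ∑ i ∈ I, if P i σ then 0 else 1) ≤ I.card * δ := by
    rw [wExp_sum, ← nsmul_eq_mul]
    exact Finset.sum_le_card_nsmul _ _ _ hP
  rw [gibbsProb_eq_wExp]
  calc 1 - I.card * δ
      ≤ wExp w (fun _ => 1) - wExp w (fun σ => ∑ i ∈ I, if P i σ then 0 else 1) := by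
        rw [wExp_const hw.sum_pos]
        gcongr
    _ = wExp w (fun σ => 1 - ∑ i ∈ I, if P i σ then 0 else 1) := (wExp_sub _ _).symm
    _ ≤ _ := wExp_mono hw.nonneg fun σ => ?_
  split_ifs with hσ
  · rw [sub_le_self_iff]
    exact Finset.sum_nonneg fun i _ => by split_ifs <;> norm_num
  · obtain ⟨i, hi, hPi⟩ : ∃ i ∈ I, ¬ P i σ := by
      by_contra! hcon
      exact hσ (hA σ hcon)
    rw [sub_nonpos]
    refine le_trans ?_ (Finset.single_le_sum (f := fun i => if P i σ then (0 : ℝ) else 1)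
      (fun j _ => by split_ifs <;> norm_num) hi)
    simp [hPi]

lemma maxDegN_sub_minDegN_le [NeZero n] {G : SimpleGraph (Fin n)} {m a : ℝ}
    (h : ∀ v, |(degN G v : ℝ) - m| ≤ a) : (maxDegN G : ℝ) - minDegN G ≤ 2 * a := by
  obtain ⟨u, -, hu⟩ := Finset.exists_mem_eq_sup Finset.univ Finset.univ_nonempty (degN G)
  obtain ⟨v, hv⟩ := Nat.sInf_mem (Set.range_nonempty (degN G))
  rw [maxDegN, minDegN, hu, ← hv]
  linarith [abs_le.1 (h u), abs_le.1 (h v)]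

end PairEncoding

section Asymptotics

/-- Quantitative conditions under which the concentration bounds hold at a given `n`. -/
structure Regime (n : ℕ) (l ζ ε γ B : ℝ) : Prop where
  le_n : 64 ≤ n
  l_pos : 0 < l
  l_le : 8 * l ≤ 1
  ζ_pos : 0 < ζ
  ζ_le : ζ ≤ 1
  ε_pos : 0 < ε
  ε_le : ε ≤ ζ
  γ_pos : 0 < γ
  γ_le : γ ≤ 1
  one_le_B : 1 ≤ B
  gap : l * ζ * ((1 + ε) ^ 2 * (2 * n * l)) ≤ 1 - γ
  exp_le : Real.exp (B / √(n * l)) ≤ 1 + ε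
  small : (n : ℝ) ^ 8 * Real.exp (-(ε ^ 2 / 2 * (n * l))) ≤ 1

lemma exp_sub_one_le_two_mul {x : ℝ} (h0 : 0 ≤ x) (h1 : x ≤ 1) : Real.exp x - 1 ≤ 2 * x := by
  have := (abs_le.1 (Real.abs_exp_sub_one_sub_id_le (by rwa [abs_of_nonneg h0]))).2
  nlinarith

namespace Regime

variable {n : ℕ} {l ζ ε γ B : ℝ}

/-- Bound on the number of present neighbours of a pair. -/
local notation "sparsity" => (1 + ε) ^ 2 * (2 * (n : ℝ) * l)

/-- Bound on the probability of not being sparse. -/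
local notation "defect" => (n : ℝ) ^ 2 * Real.exp (-(ε ^ 2 / 2 * (n * l)))

lemma n_pos (h : Regime n l ζ ε γ B) : (0 : ℝ) < n := by
  have := h.le_n
  exact_mod_cast (by omega : 0 < n)

lemma one_le_n (h : Regime n l ζ ε γ B) : (1 : ℝ) ≤ n := by
  have := h.le_n
  exact_mod_cast (by omega : 1 ≤ n)

lemma sparsity_pos (h : Regime n l ζ ε γ B) : 0 < sparsity := by
  have := h.n_pos; have := h.l_pos; have := h.ε_pos
  positivity

lemma sparsity_le (h : Regime n l ζ ε γ B) : sparsity ≤ 8 * (n * l) := by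
  have := h.n_pos; have := h.l_pos; have := h.ε_pos; have := h.ε_le; have := h.ζ_le
  calc sparsity ≤ (1 + 1) ^ 2 * (2 * (n : ℝ) * l) := by gcongr; linarith
    _ = _ := by ring

lemma sparsity_le_n (h : Regime n l ζ ε γ B) : sparsity ≤ n := by
  have := h.sparsity_le; have := h.n_pos; have := h.l_le
  nlinarith

lemma le_sqrt (h : Regime n l ζ ε γ B) : B ≤ √(n * l) := by
  have := h.n_pos; have := h.l_pos
  have hpos : 0 < √(n * l) := by positivity
  have h1 := h.exp_le
  have h2 := Real.add_one_le_exp (B / √(n * l))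
  have h3 : B / √(n * l) ≤ 1 := by linarith [h.ε_le, h.ζ_le]
  rwa [div_le_one hpos] at h3

lemma one_le_mul (h : Regime n l ζ ε γ B) : 1 ≤ n * l := by
  have := h.le_sqrt.trans' h.one_le_B
  rwa [Real.one_le_sqrt] at this

variable {τ : ℝ}

lemma exp_le_of_le (h : Regime n l ζ ε γ B) (hτ' : τ ≤ B / √(n * l)) :
    Real.exp τ ≤ 1 + ε := (Real.exp_le_exp.2 hτ').trans h.exp_le

lemma le_one_of_le (h : Regime n l ζ ε γ B) (hτ' : τ ≤ B / √(n * l)) : τ ≤ 1 := by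
  linarith [h.exp_le_of_le hτ', Real.add_one_le_exp τ, h.ε_le, h.ζ_le]

lemma card_mul_exp_le (h : Regime n l ζ ε γ B) (hτ' : τ ≤ B / √(n * l)) :
    Fintype.card (Pair n) * Real.exp (-(ε / 2 * sparsity)
      + (2 * n) * ((Real.exp (ε / 2) - 1) * (l * Real.exp τ))) ≤ defect := by
  have hn := h.n_pos; have hl := h.l_pos; have hε := h.ε_pos; have hε1 := h.ε_le.trans h.ζ_le
  have hs : Real.exp (ε / 2) - 1 ≤ ε / 2 + (ε / 2) ^ 2 := by
    have := (abs_le.1 (Real.abs_exp_sub_one_sub_id_le (x := ε / 2)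
      (by rw [abs_of_nonneg] <;> linarith))).2
    linarith
  have hτε := h.exp_le_of_le hτ'
  gcongr
  · exact_mod_cast card_pair_le
  · have h1 : (Real.exp (ε / 2) - 1) * (l * Real.exp τ)
        ≤ (ε / 2 + (ε / 2) ^ 2) * (l * (1 + ε)) := by gcongr
    have h2 : 0 ≤ n * l * ε ^ 3 := by positivity
    nlinarith [mul_le_mul_of_nonneg_left h1 (by positivity : 0 ≤ 2 * (n : ℝ))]

lemma theta_lt (h : Regime n l ζ ε γ B) : l * (1 - (1 - ζ)) * sparsity < 1 := by
  have := h.gap; have := h.γ_pos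
  rw [sub_sub_cancel]
  linarith

lemma le_one_sub_theta (h : Regime n l ζ ε γ B) : γ ≤ 1 - l * (1 - (1 - ζ)) * sparsity := by
  have := h.gap
  rw [sub_sub_cancel]
  linarith

lemma pow_mul_defect_le (h : Regime n l ζ ε γ B) {k : ℕ} (hk : k ≤ 6) :
    (n : ℝ) ^ k * defect ≤ 1 := by
  refine le_trans ?_ h.small
  rw [← mul_assoc, ← pow_add]
  gcongr
  · exact h.one_le_n
  · omega

lemma card_pair_le_real (n : ℕ) : (Fintype.card (Pair n) : ℝ) ≤ (n : ℝ) ^ 2 := by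
  exact_mod_cast card_pair_le

lemma nonempty (h : Regime n l ζ ε γ B) : Nonempty (Pair n) :=
  nonempty_pair (by have := h.le_n; omega)

lemma tail_card (h : Regime n l ζ ε γ B) (S : Finset (Pair n)) (hτ : 0 ≤ τ)
    (hτ' : τ ≤ B / √(n * l)) (hS : τ ^ 2 * l * S.card ≤ B ^ 2) (a : ℝ) :
    wExp (tripleWeight (triples n) l (1 - ζ)) (fun σ => if |((σ ∩ S).card : ℝ)
        - wExp (tripleWeight (triples n) l (1 - ζ)) (fun σ => ((σ ∩ S).card : ℝ))| ≤ a
        then 0 else 1)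
      ≤ 2 * Real.exp (-(τ * a) + (128 * B ^ 2 + 13) / γ) := by
  have := h.nonempty
  refine (_root_.tail_card isLinearTriples_triples h.l_pos (sub_nonneg.2 h.ζ_le)
    (by linarith [h.ζ_pos]) h.sparsity_pos h.theta_lt
    (fun g => by exact_mod_cast card_nbrs_triples_le g) (half_pos h.ε_pos).le hτ
    (h.card_mul_exp_le hτ') S a).trans ?_
  have hl := h.l_pos
  have hγ := h.γ_pos
  have h1 := h.le_one_of_le hτ'
  have hE := card_pair_le_real n
  have hE' := exp_sub_one_le_two_mul hτ h1
  have hβ0 : 0 ≤ defect := by positivity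
  have hA : τ * (1 * ((l * (S.card * (Real.exp τ - 1)) + 7 * (Fintype.card (Pair n) : ℝ) ^ 2 * defect)
      / (1 - l * (1 - (1 - ζ)) * sparsity))) ≤ (2 * B ^ 2 + 7) / γ := by
    rw [one_mul, mul_div_assoc']
    gcongr ?_ / ?_
    swap
    · exact h.le_one_sub_theta
    · calc τ * (l * (S.card * (Real.exp τ - 1)) + 7 * (Fintype.card (Pair n) : ℝ) ^ 2 * defect)
          = τ * (l * (S.card * (Real.exp τ - 1)))
            + 7 * (τ * ((Fintype.card (Pair n) : ℝ) ^ 2 * defect)) := by ring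
        _ ≤ τ * (l * (S.card * (2 * τ))) + 7 * (1 * (((n : ℝ) ^ 2) ^ 2 * defect)) := by gcongr
        _ = 2 * (τ ^ 2 * l * S.card) + 7 * ((n : ℝ) ^ 4 * defect) := by ring
        _ ≤ 2 * B ^ 2 + 7 := by
          have := h.pow_mul_defect_le (k := 4) (by norm_num)
          linarith
  have hB : τ * (2 * (2 * Fintype.card (Pair n) + 1 * Fintype.card (Pair n)) * defect) ≤ 6 / γ := by
    calc τ * (2 * (2 * Fintype.card (Pair n) + 1 * Fintype.card (Pair n)) * defect)
        = 6 * (τ * (Fintype.card (Pair n) * defect)) := by ring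
      _ ≤ 6 * (1 * ((n : ℝ) ^ 2 * defect)) := by gcongr
      _ ≤ 6 := by linarith [h.pow_mul_defect_le (k := 2) (by norm_num)]
      _ ≤ 6 / γ := by rw [le_div_iff₀ hγ]; linarith [h.γ_le]
  have hC : (2 * B ^ 2 + 7) / γ + 6 / γ ≤ (128 * B ^ 2 + 13) / γ := by
    rw [← add_div]
    gcongr ?_ / γ
    nlinarith [sq_nonneg B]
  gcongr
  linarith

lemma tail_tripleCount (h : Regime n l ζ ε γ B) (hτ : 0 ≤ τ)
    (hτ' : τ ≤ B / √(n * l)) (hτT : τ * (8 * (n * l)) ≤ 1)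
    (hV : τ ^ 2 * ((n : ℝ) ^ 4 * l ^ 3) ≤ B ^ 2) (a : ℝ) :
    wExp (tripleWeight (triples n) l (1 - ζ)) (fun σ => if |(tripleCount (triples n) σ : ℝ)
        - wExp (tripleWeight (triples n) l (1 - ζ)) (fun σ => (tripleCount (triples n) σ : ℝ))| ≤ a
        then 0 else 1)
      ≤ 2 * Real.exp (-(τ * a) + (128 * B ^ 2 + 13) / γ) := by
  have := h.nonempty
  refine (_root_.tail_tripleCount isLinearTriples_triples h.l_pos (sub_nonneg.2 h.ζ_le)
    (by linarith [h.ζ_pos]) h.sparsity_pos h.theta_lt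
    (fun g => by exact_mod_cast card_nbrs_triples_le g) (half_pos h.ε_pos).le hτ
    (h.card_mul_exp_le hτ') ?_ a).trans ?_
  · have := h.exp_le_of_le hτ'
    have := mul_le_mul_of_nonneg_left this (sub_nonneg.2 h.ζ_le)
    nlinarith [h.ε_pos, h.ζ_pos, h.ε_le]
  have hl := h.l_pos
  have hγ := h.γ_pos
  have h1 := h.le_one_of_le hτ'
  have hE := card_pair_le_real n
  have hT0 := h.sparsity_pos
  have hT := h.sparsity_le
  have hTn := h.sparsity_le_n
  have htri : ((triples n).card : ℝ) ≤ (n : ℝ) ^ 3 := by exact_mod_cast card_triples_le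
  set T := sparsity
  have hE' := exp_sub_one_le_two_mul (mul_nonneg hτ hT0.le)
    ((mul_le_mul_of_nonneg_left hT hτ).trans hτT)
  have hβ0 : 0 ≤ defect := by positivity
  have hexp : 0 ≤ Real.exp (τ * T) - 1 := by
    linarith [Real.one_le_exp (mul_nonneg hτ hT0.le)]
  have hA : τ * (T * ((l * (Fintype.card (Pair n) * (Real.exp (τ * T) - 1))
      + 7 * (Fintype.card (Pair n) : ℝ) ^ 2 * defect) / (1 - l * (1 - (1 - ζ)) * T)))
      ≤ (128 * B ^ 2 + 7) / γ := by
    rw [mul_div_assoc', mul_div_assoc']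
    gcongr ?_ / ?_
    swap
    · exact h.le_one_sub_theta
    · calc τ * (T * (l * (Fintype.card (Pair n) * (Real.exp (τ * T) - 1))
              + 7 * (Fintype.card (Pair n) : ℝ) ^ 2 * defect))
          = τ * (T * (l * (Fintype.card (Pair n) * (Real.exp (τ * T) - 1))))
            + 7 * (τ * (T * ((Fintype.card (Pair n) : ℝ) ^ 2 * defect))) := by ring
        _ ≤ τ * ((8 * (n * l)) * (l * ((n : ℝ) ^ 2 * (2 * (τ * (8 * (n * l)))))))
            + 7 * (1 * (n * (((n : ℝ) ^ 2) ^ 2 * defect))) := by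
          gcongr
          exact hE'.trans (by gcongr)
        _ = 128 * (τ ^ 2 * ((n : ℝ) ^ 4 * l ^ 3)) + 7 * ((n : ℝ) ^ 5 * defect) := by ring
        _ ≤ 128 * B ^ 2 + 7 := by
          have := h.pow_mul_defect_le (k := 5) (by norm_num)
          linarith
  have hB : τ * (2 * (2 * (triples n).card + T * Fintype.card (Pair n)) * defect) ≤ 6 / γ := by
    calc τ * (2 * (2 * (triples n).card + T * Fintype.card (Pair n)) * defect)
        ≤ 1 * (2 * (2 * (n : ℝ) ^ 3 + n * (n : ℝ) ^ 2) * defect) := by gcongr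
      _ = 6 * ((n : ℝ) ^ 3 * defect) := by ring
      _ ≤ 6 := by linarith [h.pow_mul_defect_le (k := 3) (by norm_num)]
      _ ≤ 6 / γ := by rw [le_div_iff₀ hγ]; linarith [h.γ_le]
  have hC : (128 * B ^ 2 + 7) / γ + 6 / γ = (128 * B ^ 2 + 13) / γ := by
    rw [← add_div]
    ring
  gcongr
  linarith

lemma two_mul_exp_le {n : ℕ} {K C τ a : ℝ} (hn : 2 * Real.exp C ≤ n)
    (ha : (K + 2) * Real.log n ≤ τ * a) :
    2 * Real.exp (-(τ * a) + C) ≤ (n : ℝ) ^ (-K) / n := by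
  have hn0 : (0 : ℝ) < n := by linarith [Real.exp_pos C]
  have h1 : Real.exp (-(τ * a)) ≤ (n : ℝ) ^ (-K) / (n : ℝ) ^ 2 := by
    rw [← Real.rpow_natCast, ← Real.rpow_sub hn0, Real.rpow_def_of_pos hn0]
    refine Real.exp_le_exp.2 ?_
    push_cast
    linarith
  calc 2 * Real.exp (-(τ * a) + C) = Real.exp (-(τ * a)) * (2 * Real.exp C) := by
        rw [Real.exp_add]; ring
    _ ≤ (n : ℝ) ^ (-K) / (n : ℝ) ^ 2 * n := by gcongr
    _ = _ := by field_simp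

variable {K : ℝ}

lemma one_sub_le_gibbsProb_edgeCount (h : Regime n l ζ ε γ (K + 2))
    (hn : 2 * Real.exp ((128 * (K + 2) ^ 2 + 13) / γ) ≤ n) :
    1 - (n : ℝ) ^ (-K) ≤ gibbsProb n l ζ
      {G | |(edgeCount G : ℝ) - gibbsExp n l ζ (fun G => (edgeCount G : ℝ))|
        ≤ n * √l * Real.log n} := by
  have hl := h.l_pos
  have hn0 := h.n_pos
  have hB := h.one_le_B
  have hτ' : (K + 2) / (n * √l) ≤ (K + 2) / √(n * l) := by
    rw [Real.sqrt_mul hn0.le]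
    gcongr
    exact Real.sqrt_le_iff.2 ⟨hn0.le, le_self_pow₀ h.one_le_n two_ne_zero⟩
  refine le_trans ?_ (one_sub_le_gibbsProb (Finset.univ : Finset Unit) (δ := (n : ℝ) ^ (-K)) hl.le
    h.ζ_le (fun _ σ => |((σ ∩ Finset.univ).card : ℝ) - wExp (tripleWeight (triples n) l (1 - ζ))
      (fun σ => ((σ ∩ Finset.univ).card : ℝ))| ≤ n * √l * Real.log n)
      (fun _ _ => ?_) fun σ hσ => ?_)
  · simp
  · refine (h.tail_card Finset.univ (τ := (K + 2) / (n * √l)) (by positivity) hτ' ?_ _).trans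
      ((two_mul_exp_le (K := K) hn ?_).trans (div_le_self (by positivity) h.one_le_n))
    · rw [Finset.card_univ, div_pow, mul_pow, Real.sq_sqrt hl.le]
      calc _ ≤ (K + 2) ^ 2 / ((n : ℝ) ^ 2 * l) * l * (n : ℝ) ^ 2 := by
            gcongr
            exact card_pair_le_real n
        _ = _ := by field_simp
    · exact le_of_eq (by field_simp)
  · have := hσ () (Finset.mem_univ _)
    simp only [Finset.inter_univ, ← edgeCount_toGraph] at this
    rwa [← gibbsExp_eq_wExp l ζ fun G => (edgeCount G : ℝ)] at this

lemma one_sub_le_gibbsProb_triCount (h : Regime n l ζ ε γ (K + 2))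
    (hn : 2 * Real.exp ((128 * (K + 2) ^ 2 + 13) / γ) ≤ n) :
    1 - (n : ℝ) ^ (-K) ≤ gibbsProb n l ζ
      {G | |(triCount G : ℝ) - gibbsExp n l ζ (fun G => (triCount G : ℝ))|
        ≤ (n : ℝ) ^ 2 * l ^ ((3 : ℝ) / 2) * Real.log n ^ 3} := by
  have hl := h.l_pos
  have hn0 := h.n_pos
  have hB := h.one_le_B
  have hrpow : l ^ ((3 : ℝ) / 2) = l * √l := by
    rw [Real.sqrt_eq_rpow, show (3 : ℝ) / 2 = 1 + 1 / 2 by norm_num, Real.rpow_add hl,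
      Real.rpow_one]
  rw [hrpow]
  set V := (n : ℝ) ^ 2 * (l * √l) with hV
  have hVpos : 0 < V := by positivity
  have hV2 : V ^ 2 = (n : ℝ) ^ 4 * l ^ 3 := by
    rw [hV, mul_pow, mul_pow, Real.sq_sqrt hl.le]
    ring
  have h8 : 8 ≤ √(n : ℝ) := by
    rw [show (8 : ℝ) = √64 by rw [show (64 : ℝ) = 8 ^ 2 by norm_num]; simp]
    exact Real.sqrt_le_sqrt (by exact_mod_cast h.le_n)
  have hsq : √(n : ℝ) * √(n : ℝ) = n := Real.mul_self_sqrt hn0.le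
  have hVle : √(n * l) ≤ V := by
    rw [Real.sqrt_mul hn0.le, hV]
    calc √(n : ℝ) * √l ≤ n * √l := by
          gcongr
          exact Real.sqrt_le_iff.2 ⟨hn0.le, le_self_pow₀ h.one_le_n two_ne_zero⟩
      _ ≤ (n * √l) * (n * l) := le_mul_of_one_le_right (by positivity) h.one_le_mul
      _ = _ := by ring
  have hτ' : (K + 2) / V ≤ (K + 2) / √(n * l) := by gcongr
  have hlog : 1 ≤ Real.log n := by
    rw [Real.le_log_iff_exp_le hn0]
    have : (64 : ℝ) ≤ n := by exact_mod_cast h.le_n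
    linarith [Real.exp_one_lt_d9]
  refine le_trans ?_ (one_sub_le_gibbsProb (Finset.univ : Finset Unit) (δ := (n : ℝ) ^ (-K)) hl.le
    h.ζ_le (fun _ σ => |(tripleCount (triples n) σ : ℝ) - wExp (tripleWeight (triples n) l (1 - ζ))
      (fun σ => (tripleCount (triples n) σ : ℝ))| ≤ V * Real.log n ^ 3)
      (fun _ _ => ?_) fun σ hσ => ?_)
  · simp
  · refine (h.tail_tripleCount (τ := (K + 2) / V) (by positivity) hτ' ?_ ?_ _).trans
      ((two_mul_exp_le (K := K) hn ?_).trans (div_le_self (by positivity) h.one_le_n))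
    · rw [div_mul_eq_mul_div, div_le_one hVpos]
      calc (K + 2) * (8 * (n * l)) ≤ √(n * l) * (√n * (n * l)) := by
            gcongr
            exact h.le_sqrt
        _ = (√n * √n) * (n * (l * √l)) := by rw [Real.sqrt_mul hn0.le]; ring
        _ = V := by rw [hsq, hV]; ring
    · rw [div_pow, hV2]
      exact le_of_eq (by field_simp)
    · rw [div_mul_eq_mul_div, le_div_iff₀ hVpos]
      have : Real.log n ≤ Real.log n ^ 3 := le_self_pow₀ hlog (by norm_num)
      calc (K + 2) * Real.log n * V ≤ (K + 2) * Real.log n ^ 3 * V := by gcongr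
        _ = _ := by ring
  · have := hσ () (Finset.mem_univ _)
    simp only [← triCount_toGraph] at this
    rwa [← gibbsExp_eq_wExp l ζ fun G => (triCount G : ℝ)] at this

lemma one_sub_le_gibbsProb_degN (h : Regime n l ζ ε γ (K + 2))
    (hn : 2 * Real.exp ((128 * (K + 2) ^ 2 + 13) / γ) ≤ n) :
    1 - (n : ℝ) ^ (-K) ≤ gibbsProb n l ζ
      {G | (maxDegN G : ℝ) - minDegN G ≤ 4 * √(n * l) * Real.log n} := by
  have hl := h.l_pos
  have hn0 := h.n_pos
  have hB := h.one_le_B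
  have : NeZero n := ⟨by have := h.le_n; omega⟩
  have hlog := Real.log_nonneg h.one_le_n
  refine le_trans ?_ (one_sub_le_gibbsProb (Finset.univ : Finset (Fin n))
    (δ := (n : ℝ) ^ (-K) / n) hl.le h.ζ_le
    (fun v σ => |((σ ∩ pairsAt v).card : ℝ) - wExp (tripleWeight (triples n) l (1 - ζ))
      (fun σ => ((σ ∩ pairsAt v).card : ℝ))| ≤ 2 * √(n * l) * Real.log n)
      (fun v _ => ?_) fun σ hσ => ?_)
  · rw [Finset.card_univ, Fintype.card_fin, mul_div_cancel₀ _ hn0.ne']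
  · refine (h.tail_card (pairsAt v) (τ := (K + 2) / √(n * l)) (by positivity) le_rfl ?_ _).trans
      (two_mul_exp_le (K := K) hn ?_)
    · rw [div_pow, Real.sq_sqrt (by positivity)]
      calc _ ≤ (K + 2) ^ 2 / (n * l) * l * (n : ℝ) := by
            gcongr
            exact card_pairsAt_le v
        _ = _ := by field_simp
    · rw [div_mul_eq_mul_div, le_div_iff₀ (by positivity)]
      have : 0 ≤ (K + 2) * Real.log n * √(n * l) := by positivity
      linarith
  · simp only [← degN_toGraph] at hσ
    rw [Set.mem_ofPred_eq]
    refine (maxDegN_sub_minDegN_le (m := gibbsExp n l ζ fun G => (degN G 0 : ℝ)) fun v => ?_).trans_eq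
      (by ring : 2 * (2 * √(n * l) * Real.log n) = _)
    rw [gibbsExp_degN_eq l ζ 0 v, gibbsExp_eq_wExp]
    exact hσ v (Finset.mem_univ v)

end Regime

lemma eventually_regime {ζ c : ℝ} (hζ : ζ ∈ Set.Ioc (0 : ℝ) 1) (hc : 0 < c)
    (hξ : 2 * ζ * c ^ 2 < 1) {l : ℕ → ℝ} (hl : ∀ n, 0 < l n)
    (hlc : Tendsto (fun n : ℕ => √n * l n) atTop (nhds c)) {B : ℝ} (hB : 1 ≤ B) :
    ∃ ε γ : ℝ, ∀ᶠ n : ℕ in atTop, Regime n (l n) ζ ε γ B := by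
  obtain ⟨ε, hε, hεζ, hgap⟩ : ∃ ε : ℝ, 0 < ε ∧ ε ≤ ζ ∧ 2 * ζ * c ^ 2 * (1 + ε) ^ 2 < 1 := by
    have hcont : Tendsto (fun ε : ℝ => 2 * ζ * c ^ 2 * (1 + ε) ^ 2) (nhds 0)
        (nhds (2 * ζ * c ^ 2 * (1 + 0) ^ 2)) :=
      Continuous.tendsto (by fun_prop) 0
    have h1 := (hcont.mono_left (nhdsWithin_le_nhds (s := Set.Ioi 0))).eventually_lt_const
      (by simpa using hξ)
    obtain ⟨ε, h1, h2⟩ := (h1.and (Ioc_mem_nhdsGT hζ.1)).exists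
    exact ⟨ε, h2.1, h2.2, h1⟩
  obtain ⟨γ, hγ, hγ1, hγgap⟩ : ∃ γ : ℝ, 0 < γ ∧ γ ≤ 1 ∧ 2 * ζ * c ^ 2 * (1 + ε) ^ 2 < 1 - γ := by
    have : 0 ≤ 2 * ζ * c ^ 2 * (1 + ε) ^ 2 := by have := hζ.1; positivity
    exact ⟨(1 - 2 * ζ * c ^ 2 * (1 + ε) ^ 2) / 2, by linarith, by linarith, by linarith⟩
  refine ⟨ε, γ, ?_⟩
  have hsqrt : Tendsto (fun n : ℕ => √(n : ℝ)) atTop atTop :=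
    Real.tendsto_sqrt_atTop.comp tendsto_natCast_atTop_atTop
  have hmul : ∀ n : ℕ, √(n : ℝ) * (√n * l n) = n * l n := fun n => by
    rw [← mul_assoc, Real.mul_self_sqrt n.cast_nonneg]
  have hnl : Tendsto (fun n : ℕ => (n : ℝ) * l n) atTop atTop := by
    simpa only [hmul] using hsqrt.atTop_mul_pos hc hlc
  have hl0 : Tendsto l atTop (nhds 0) := by
    refine (hlc.div_atTop hsqrt).congr' ?_
    filter_upwards [eventually_gt_atTop 0] with n hn
    have : (0 : ℝ) < √n := Real.sqrt_pos.2 (by exact_mod_cast hn)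
    field_simp
  have hexp : Tendsto (fun n : ℕ => Real.exp (B / √(n * l n))) atTop (nhds 1) := by
    have := (Real.tendsto_sqrt_atTop.comp hnl).const_div_atTop B
    simpa [Function.comp_def] using (Real.continuous_exp.tendsto 0).comp this
  have hgap' : Tendsto (fun n : ℕ => 2 * ζ * (√n * l n) ^ 2 * (1 + ε) ^ 2) atTop
      (nhds (2 * ζ * c ^ 2 * (1 + ε) ^ 2)) := ((hlc.pow 2).const_mul _).mul_const _
  have hpow : ∀ᶠ n : ℕ in atTop, √(n : ℝ) ^ 16 ≤ Real.exp (ε ^ 2 / 2 * (c / 2) * √n) := by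
    have := (isLittleO_pow_exp_pos_mul_atTop 16
      (by positivity : 0 < ε ^ 2 / 2 * (c / 2))).bound one_pos
    filter_upwards [hsqrt.eventually this] with n hn
    simpa [abs_of_nonneg (Real.sqrt_nonneg _)] using hn
  filter_upwards [eventually_ge_atTop 64, hl0.eventually_le_const (by norm_num : (0 : ℝ) < 1 / 8),
    hexp.eventually_le_const (by linarith : 1 < 1 + ε), hgap'.eventually_le_const hγgap, hpow,
    hlc.eventually_const_le (by linarith : c / 2 < c)] with n h1 h2 h3 h4 h5 h6
  refine ⟨h1, hl n, by linarith, hζ.1, hζ.2, hε, hεζ, hγ, hγ1, hB, ?_, h3, ?_⟩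
  · refine le_of_eq_of_le ?_ h4
    rw [mul_pow, Real.sq_sqrt n.cast_nonneg]
    ring
  · rw [Real.exp_neg, ← div_eq_mul_inv, div_le_one (Real.exp_pos _)]
    calc (n : ℝ) ^ 8 = √(n : ℝ) ^ 16 := by
          rw [show 16 = 2 * 8 by norm_num, pow_mul, Real.sq_sqrt n.cast_nonneg]
      _ ≤ _ := h5
      _ ≤ _ := Real.exp_le_exp.2 ?_
    rw [← hmul, mul_assoc, mul_comm (c / 2)]
    gcongr

end Asymptotics

/-- **Lemma (concentration for `μ_{λ,ζ}`): degrees, edges and triangles concentrate with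
very high probability.** -/
theorem gibbs_concentration
    (zeta c : ℝ) (hzeta : zeta ∈ Set.Ioc (0 : ℝ) 1) (hc : 0 < c)
    (hxi : 2 * zeta * c ^ 2 < 1)
    (lam : ℕ → ℝ) (hlam : ∀ n, 0 < lam n)
    (hlc : Tendsto (fun n : ℕ => Real.sqrt n * lam n) atTop (nhds c)) :
    ∀ K : ℝ, 0 < K → ∀ᶠ n : ℕ in atTop,
      1 - (n : ℝ) ^ (-K) ≤
        gibbsProb n (lam n) zeta
          {G | (maxDegN G : ℝ) - (minDegN G : ℝ) ≤
            4 * Real.sqrt ((n : ℝ) * lam n) * Real.log n} ∧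
      1 - (n : ℝ) ^ (-K) ≤
        gibbsProb n (lam n) zeta
          {G | |(edgeCount G : ℝ) - gibbsExp n (lam n) zeta (fun G => (edgeCount G : ℝ))| ≤
            (n : ℝ) * Real.sqrt (lam n) * Real.log n} ∧
      1 - (n : ℝ) ^ (-K) ≤
        gibbsProb n (lam n) zeta
          {G | |(triCount G : ℝ) - gibbsExp n (lam n) zeta (fun G => (triCount G : ℝ))| ≤
            (n : ℝ) ^ 2 * lam n ^ ((3 : ℝ) / 2) * Real.log n ^ 3} := by
  intro K hK
  obtain ⟨ε, γ, hreg⟩ := eventually_regime hzeta hc hxi hlam hlc (by linarith : 1 ≤ K + 2)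
  filter_upwards [hreg, tendsto_natCast_atTop_atTop.eventually_ge_atTop
    (2 * Real.exp ((128 * (K + 2) ^ 2 + 13) / γ))] with n h hn
  exact ⟨h.one_sub_le_gibbsProb_degN hn, h.one_sub_le_gibbsProb_edgeCount hn,
    h.one_sub_le_gibbsProb_triCount hn⟩
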